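/- arXiv:1401.1865 — 3 statements merged into one kernel-verified Lean document; each statement's English description precedes it below -/
import Mathlib

section
/- Let t_1,…,t_5 be integers with 0 ≤ t_1 ≤ 2 and 0 ≤ t_i ≤ 1 for i = 2,…,5, and let G = C_5(t_1,…,t_5) be the graph obtained from a 5-cycle by attaching, at its i-th vertex, a pendant path with t_i edges. Then the third largest eigenvalue of G is strictly less than √2 and the third smallest eigenvalue of G is strictly greater than −√2. -/
open Polynomial in
/-- `μ` is the sequence of adjacency eigenvalues of `G`, listed with multiplicity
in decreasing order (so `μ ⟨i-1,_⟩` is the `i`-th largest eigenvalue `λ_i`). -/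
def SimpleGraph.IsEigenvalueSeq {V : Type*} [Fintype V] [DecidableEq V]
    (G : SimpleGraph V) (μ : Fin (Fintype.card V) → ℝ) : Prop :=
  Antitone μ ∧
    (letI : DecidableRel G.Adj := Classical.decRel _
     (SimpleGraph.adjMatrix ℝ G).charpoly) =
      ∏ i : Fin (Fintype.card V), (X - C (μ i))

/-- The graph `C₅(t₀,…,t₄)`, obtained from a 5-cycle (on the vertices `Sum.inl i`,
`i : Fin 5`) by attaching at its `i`-th vertex a pendant path with `t i` edges (whose
vertices are `Sum.inr ⟨i, j⟩`, `j : Fin (t i)`). -/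
def cycleFivePendant (t : Fin 5 → ℕ) :
    SimpleGraph ((Fin 5) ⊕ (Σ i : Fin 5, Fin (t i))) :=
  SimpleGraph.fromRel (fun x y =>
    match x, y with
    | Sum.inl i, Sum.inl j => j = i + 1
    | Sum.inl i, Sum.inr ⟨i', j⟩ => i = i' ∧ (j : ℕ) = 0
    | Sum.inr ⟨i, j⟩, Sum.inr ⟨i', j'⟩ => i = i' ∧ (j' : ℕ) = (j : ℕ) + 1
    | _, _ => False)

open Polynomial in
lemma exists_test_vector {V : Type*} [Fintype V] [DecidableEq V] (A : Matrix V V ℝ)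
    (hA : A.IsHermitian) (μ : Fin (Fintype.card V) → ℝ)
    (hanti : Antitone μ) (h : A.charpoly = ∏ i, (X - C (μ i)))
    (p : Fin 3 → Fin (Fintype.card V)) (hp : Function.Injective p)
    (f : (V → ℝ) →ₗ[ℝ] (Fin 2 → ℝ)) :
    ∃ x : V → ℝ, x ≠ 0 ∧ f x = 0 ∧ ∃ c : Fin 3 → ℝ,
      x ⬝ᵥ x = ∑ k, c k ^ 2 ∧ x ⬝ᵥ (A.mulVec x) = ∑ k, μ (p k) * c k ^ 2 := by
  have hroots : (List.ofFn μ).Perm (List.ofFn hA.eigenvalues₀) := by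
    have h1 := hA.roots_charpoly_eq_eigenvalues₀
    have h3 : Multiset.map (fun i => X - C (μ i)) Finset.univ.val
        = Multiset.map (fun a => X - C a) (Multiset.map μ Finset.univ.val) := by
      rw [Multiset.map_map]; rfl
    rw [h, Finset.prod_eq_multiset_prod, h3, Polynomial.roots_multiset_prod_X_sub_C, Fin.univ_val_map, Fin.univ_val_map] at h1
    exact Multiset.coe_eq_coe.1 h1
  have hσ : μ = hA.eigenvalues₀ := List.ofFn_injective
    (hroots.eq_of_sortedGE hanti.sortedGE_ofFn hA.eigenvalues₀_antitone.sortedGE_ofFn)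
  let e : Fin (Fintype.card V) ≃ V := Fintype.equivOfCardEq (Fintype.card_fin _)
  let q : Fin 3 → V := fun k => e (p k)
  have hq : Function.Injective q := fun a b hab => hp (e.injective hab)
  have hμq : ∀ k, μ (p k) = hA.eigenvalues (q k) := fun k => by
    rw [hσ]; simp [Matrix.IsHermitian.eigenvalues, q, e]
  let v : Fin 3 → V → ℝ := fun k => ⇑(hA.eigenvectorBasis (q k))
  have hAv : ∀ k, A.mulVec (v k) = μ (p k) • v k := fun k => by
    rw [hμq]; exact hA.mulVec_eigenvectorBasis (q k)
  have hvv : ∀ k l, v k ⬝ᵥ v l = if k = l then 1 else 0 := fun k l => by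
    have := (orthonormal_iff_ite.1 hA.eigenvectorBasis.orthonormal) (q l) (q k)
    rw [EuclideanSpace.inner_eq_star_dotProduct] at this
    simp only [hq.eq_iff] at this
    simpa [v, eq_comm] using this
  let g : (Fin 3 → ℝ) →ₗ[ℝ] (V → ℝ) := Fintype.linearCombination ℝ v
  have hg : ∀ c, g c = ∑ k, c k • v k := fun c => Fintype.linearCombination_apply ℝ v c
  obtain ⟨c, hc, hc0⟩ : ∃ c, c ∈ LinearMap.ker (f ∘ₗ g) ∧ c ≠ 0 := by
    apply Submodule.exists_mem_ne_zero_of_ne_bot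
    apply LinearMap.ker_ne_bot_of_finrank_lt
    simp
  have hxx : g c ⬝ᵥ g c = ∑ k, c k ^ 2 := by
    simp only [hg, sum_dotProduct, dotProduct_sum, smul_dotProduct, dotProduct_smul, hvv]
    simp [pow_two]
  refine ⟨g c, ?_, by simpa using hc, c, hxx, ?_⟩
  · intro h0
    apply hc0
    rw [h0] at hxx
    simp only [dotProduct_zero] at hxx
    funext k
    have := (Finset.sum_eq_zero_iff_of_nonneg (fun i _ => sq_nonneg (c i))).1 hxx.symm k
      (Finset.mem_univ k)
    simpa using this
  · simp only [hg, Matrix.mulVec_sum, Matrix.mulVec_smul, hAv, sum_dotProduct, dotProduct_sum,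
      smul_dotProduct, dotProduct_smul, hvv]
    simp [pow_two]
    exact Finset.sum_congr rfl fun k _ => by ring

/-- value on the `j`-th vertex of the pendant path at `i`, or zero if there is none -/
noncomputable def pendVal (t : Fin 5 → ℕ) (x : (Fin 5) ⊕ (Σ i : Fin 5, Fin (t i)) → ℝ)
    (i : Fin 5) (j : ℕ) : ℝ :=
  if h : j < t i then x (Sum.inr ⟨i, ⟨j, h⟩⟩) else 0

lemma pendVal_coe (t : Fin 5 → ℕ) (x : (Fin 5) ⊕ (Σ i : Fin 5, Fin (t i)) → ℝ)
    (i : Fin 5) (j : Fin (t i)) : x (Sum.inr ⟨i, j⟩) = pendVal t x i j := by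
  simp [pendVal]

lemma pendVal_zero (t : Fin 5 → ℕ) (x : (Fin 5) ⊕ (Σ i : Fin 5, Fin (t i)) → ℝ)
    (i : Fin 5) (j : ℕ) (h : t i ≤ j) : pendVal t x i j = 0 := by
  simp [pendVal, h]

lemma sum_fin_le_two (n : ℕ) (hn : n ≤ 2) (F : ℕ → ℝ) (hF : ∀ j, n ≤ j → F j = 0) :
    ∑ j : Fin n, F j = F 0 + F 1 := by
  rw [Fin.sum_univ_eq_sum_range F n]
  interval_cases n
  · simp [hF]
  · simp [hF]
  · simp [Finset.sum_range_succ]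

lemma norm_form (t : Fin 5 → ℕ) (ht : ∀ i, t i ≤ 2)
    (x : (Fin 5) ⊕ (Σ i : Fin 5, Fin (t i)) → ℝ) :
    x ⬝ᵥ x = ∑ i, (x (Sum.inl i) ^ 2 + pendVal t x i 0 ^ 2 + pendVal t x i 1 ^ 2) := by
  simp only [dotProduct, Fintype.sum_sum_type, Fintype.sum_sigma, pendVal_coe]
  rw [← Finset.sum_add_distrib]
  refine Finset.sum_congr rfl fun i _ => ?_
  rw [sum_fin_le_two (t i) (ht i) (fun j => pendVal t x i j * pendVal t x i j)
    (fun j hj => by simp [pendVal_zero t x i j hj])]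
  ring

/-- the oriented edge relation -/
def pendRel (t : Fin 5 → ℕ) (x y : (Fin 5) ⊕ (Σ i : Fin 5, Fin (t i))) : Prop :=
    match x, y with
    | Sum.inl i, Sum.inl j => j = i + 1
    | Sum.inl i, Sum.inr ⟨i', j⟩ => i = i' ∧ (j : ℕ) = 0
    | Sum.inr ⟨i, j⟩, Sum.inr ⟨i', j'⟩ => i = i' ∧ (j' : ℕ) = (j : ℕ) + 1
    | _, _ => False

lemma pendRel_asymm (t : Fin 5 → ℕ) (x y : (Fin 5) ⊕ (Σ i : Fin 5, Fin (t i)))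
    (h : pendRel t x y) : ¬ pendRel t y x := by
  rcases x with i | ⟨i, j⟩ <;> rcases y with i' | ⟨i', j'⟩ <;> simp only [pendRel] at h ⊢
  · subst h; revert i; decide
  · simp
  · omega

lemma adj_iff (t : Fin 5 → ℕ) (x y : (Fin 5) ⊕ (Σ i : Fin 5, Fin (t i))) :
    (cycleFivePendant t).Adj x y ↔ pendRel t x y ∨ pendRel t y x := by
  have h : (cycleFivePendant t).Adj x y ↔ x ≠ y ∧ (pendRel t x y ∨ pendRel t y x) := Iff.rfl
  rw [h]
  refine ⟨fun h => h.2, fun h => ⟨?_, h⟩⟩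
  rintro rfl
  rcases h with h | h <;> exact pendRel_asymm t _ _ h h

open Classical in
lemma rel_form (t : Fin 5 → ℕ) (ht : ∀ i, t i ≤ 2)
    (x : (Fin 5) ⊕ (Σ i : Fin 5, Fin (t i)) → ℝ) :
    ∑ u, ∑ v, (if pendRel t u v then x u * x v else 0) =
      ∑ i, (x (Sum.inl i) * x (Sum.inl (i + 1)) + x (Sum.inl i) * pendVal t x i 0
        + pendVal t x i 0 * pendVal t x i 1) := by
  rw [Fintype.sum_sum_type, Fintype.sum_sigma, ← Finset.sum_add_distrib]
  refine Finset.sum_congr rfl fun i _ => ?_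
  congr 1
  · rw [Fintype.sum_sum_type]
    congr 1
    · rw [Finset.sum_eq_single (i + 1)]
      · exact if_pos rfl
      · intro j _ hj
        exact if_neg hj
      · simp
    · rw [Fintype.sum_sigma, Finset.sum_eq_single i]
      · simp only [pendRel, pendVal_coe, true_and]
        rw [sum_fin_le_two (t i) (ht i)
          (fun j => if j = 0 then x (Sum.inl i) * pendVal t x i j else 0)
          (fun j hj => by simp [pendVal_zero t x i j hj])]
        simp
      · intro i' _ hi'
        simp [pendRel, hi'.symm]
      · simp
  · have h1 : ∀ j : Fin (t i), (∑ v, if pendRel t (Sum.inr ⟨i, j⟩) v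
        then x (Sum.inr ⟨i, j⟩) * x v else 0) = pendVal t x i j * pendVal t x i (j + 1) := by
      intro j
      rw [Fintype.sum_sum_type, Fintype.sum_sigma]
      have h0 : (∑ a : Fin 5, if pendRel t (Sum.inr ⟨i, j⟩) (Sum.inl a)
          then x (Sum.inr ⟨i, j⟩) * x (Sum.inl a) else 0) = 0 := by simp [pendRel]
      rw [h0, zero_add, Finset.sum_eq_single i]
      · simp only [pendRel, pendVal_coe, true_and]
        rw [sum_fin_le_two (t i) (ht i)
          (fun j' => if j' = (j : ℕ) + 1 then pendVal t x i j * pendVal t x i j' else 0)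
          (fun j' hj => by simp [pendVal_zero t x i j' hj])]
        have hj := j.2
        have := ht i
        have hj2 : (j : ℕ) = 0 ∨ (j : ℕ) = 1 := by omega
        rcases hj2 with hj2 | hj2 
        · simp [hj2]
        · simp [hj2, pendVal_zero t x i 2 (ht i)]
      · intro i' _ hi'
        simp [pendRel, hi'.symm]
      · simp
    simp only [h1]
    rw [sum_fin_le_two (t i) (ht i) (fun j => pendVal t x i j * pendVal t x i (j + 1))
          (fun j hj => by simp [pendVal_zero t x i j hj])]
    simp [pendVal_zero t x i 2 (ht i)]

open Classical in
lemma adj_form (t : Fin 5 → ℕ) (ht : ∀ i, t i ≤ 2)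
    (x : (Fin 5) ⊕ (Σ i : Fin 5, Fin (t i)) → ℝ) :
    x ⬝ᵥ (((cycleFivePendant t).adjMatrix ℝ).mulVec x) =
      2 * ∑ i, (x (Sum.inl i) * x (Sum.inl (i + 1)) + x (Sum.inl i) * pendVal t x i 0
        + pendVal t x i 0 * pendVal t x i 1) := by
  rw [← rel_form t ht x, two_mul]
  conv_rhs => arg 2; rw [Finset.sum_comm]
  rw [← Finset.sum_add_distrib]
  simp only [dotProduct, Matrix.mulVec]
  refine Finset.sum_congr rfl fun u _ => ?_
  rw [Finset.mul_sum, ← Finset.sum_add_distrib]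
  refine Finset.sum_congr rfl fun v _ => ?_
  rw [SimpleGraph.adjMatrix_apply]
  have h1 := pendRel_asymm t u v
  by_cases h2 : pendRel t u v <;> by_cases h3 : pendRel t v u <;>
    simp_all [adj_iff] <;> ring

/-- the quadratic form estimate on a codimension two subspace -/
lemma form_bound (ε : ℝ) (hε : ε = 1 ∨ ε = -1) (s : ℝ) (hs : s ^ 2 = 2) (hs0 : 0 < s)
    (x1 x2 x3 x4 y0 y1 y2 y3 y4 z : ℝ) (h : x2 + ε * x3 = 0)
    (hle : s * (x1^2 + x2^2 + x3^2 + x4^2 + y0^2 + y1^2 + y2^2 + y3^2 + y4^2 + z^2) ≤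
      ε * (2 * (x1 * x2 + x2 * x3 + x3 * x4 + x1 * y1 + x2 * y2 + x3 * y3 + x4 * y4 + y0 * z))) :
    x1 = 0 ∧ x2 = 0 ∧ x3 = 0 ∧ x4 = 0 ∧ y0 = 0 ∧ y1 = 0 ∧ y2 = 0 ∧ y3 = 0 ∧ y4 = 0 ∧ z = 0 := by
  have hs1 : 1 < s := by nlinarith
  have hs2 : s < 2 := by nlinarith
  have hε2 : ε ^ 2 = 1 := by rcases hε with rfl | rfl <;> norm_num
  have hx2 : x2 = -ε * x3 := by linarith
  subst hx2
  have key : s * (y1 - ε * s * x1 / 2) ^ 2 + s * (y2 - ε * s * (-ε * x3) / 2) ^ 2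
      + s * (y3 - ε * s * x3 / 2) ^ 2 + s * (y4 - ε * s * x4 / 2) ^ 2
      + (s - 1) * y0 ^ 2 + (s - 1) * z ^ 2 + (y0 - ε * z) ^ 2
      + s / 2 * (x1 + s * x3) ^ 2 + s / 2 * (x4 - ε * s * x3) ^ 2 + (2 - s) * x3 ^ 2 ≤ 0 := by
    refine le_trans (le_of_eq ?_) (sub_nonpos.2 hle)
    have hs3 : s ^ 3 = 2 * s := by rw [pow_succ, hs]
    rcases hε with rfl | rfl <;> ring_nf <;> simp only [hs, hs3] <;> ring
  have e1 : 0 ≤ s * (y1 - ε * s * x1 / 2) ^ 2 := by positivity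
  have e2 : 0 ≤ s * (y2 - ε * s * (-ε * x3) / 2) ^ 2 := by positivity
  have e3 : 0 ≤ s * (y3 - ε * s * x3 / 2) ^ 2 := by positivity
  have e4 : 0 ≤ s * (y4 - ε * s * x4 / 2) ^ 2 := by positivity
  have e5 : 0 ≤ (s - 1) * y0 ^ 2 := mul_nonneg (by linarith) (sq_nonneg _)
  have e6 : 0 ≤ (s - 1) * z ^ 2 := mul_nonneg (by linarith) (sq_nonneg _)
  have e7 : 0 ≤ (y0 - ε * z) ^ 2 := sq_nonneg _
  have e8 : 0 ≤ s / 2 * (x1 + s * x3) ^ 2 := by positivity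
  have e9 : 0 ≤ s / 2 * (x4 - ε * s * x3) ^ 2 := by positivity
  have e10 : 0 ≤ (2 - s) * x3 ^ 2 := mul_nonneg (by linarith) (sq_nonneg _)
  have aux : ∀ c w : ℝ, 0 < c → c * w ^ 2 ≤ 0 → w = 0 := fun c w hc hw => by
    have : w ^ 2 ≤ 0 := by
      by_contra hcon
      have := mul_pos hc (not_le.1 hcon)
      linarith
    exact pow_eq_zero_iff (two_ne_zero) |>.1 (le_antisymm this (sq_nonneg w))
  have f3 : x3 = 0 := aux (2 - s) _ (by linarith) (by linarith)
  have f0 : y0 = 0 := aux (s - 1) _ (by linarith) (by linarith)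
  have fz : z = 0 := aux (s - 1) _ (by linarith) (by linarith)
  have f1 := aux (s / 2) (x1 + s * x3) (by linarith) (by linarith)
  have f4 := aux (s / 2) (x4 - ε * s * x3) (by linarith) (by linarith)
  have g1 := aux s _ hs0 (show s * (y1 - ε * s * x1 / 2) ^ 2 ≤ 0 by linarith)
  have g2 := aux s _ hs0 (show s * (y2 - ε * s * (-ε * x3) / 2) ^ 2 ≤ 0 by linarith)
  have g3 := aux s _ hs0 (show s * (y3 - ε * s * x3 / 2) ^ 2 ≤ 0 by linarith)
  have g4 := aux s _ hs0 (show s * (y4 - ε * s * x4 / 2) ^ 2 ≤ 0 by linarith)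
  have k1 : x1 = 0 := by simpa [f3] using f1
  have k4 : x4 = 0 := by simpa [f3] using f4
  refine ⟨k1, by simp [f3], f3, k4, f0, by simpa [k1] using g1, by simpa [f3] using g2,
    by simpa [f3] using g3, by simpa [k4] using g4, fz⟩

lemma third_aux (t : Fin 5 → ℕ) (ht0 : t 0 ≤ 2) (ht : ∀ i : Fin 5, i ≠ 0 → t i ≤ 1)
    (μ : Fin (Fintype.card ((Fin 5) ⊕ (Σ i : Fin 5, Fin (t i)))) → ℝ)
    (hμ : (cycleFivePendant t).IsEigenvalueSeq μ)
    (p : Fin 3 → Fin (Fintype.card ((Fin 5) ⊕ (Σ i : Fin 5, Fin (t i)))))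
    (hp : Function.Injective p) (ε : ℝ) (hε : ε = 1 ∨ ε = -1)
    (h : ∀ k, Real.sqrt 2 ≤ ε * μ (p k)) : False := by
  classical
  have ht2 : ∀ i, t i ≤ 2 := fun i => by
    by_cases hi : i = 0
    · rw [hi]; exact ht0
    · exact (ht i hi).trans (by norm_num)
  have hch := hμ.2
  let f : ((Fin 5) ⊕ (Σ i : Fin 5, Fin (t i)) → ℝ) →ₗ[ℝ] (Fin 2 → ℝ) :=
    LinearMap.pi ![LinearMap.proj (Sum.inl 0),
      LinearMap.proj (Sum.inl 2) + ε • LinearMap.proj (Sum.inl 3)]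
  obtain ⟨x, hx0, hfx, c, hc1, hc2⟩ := exists_test_vector
    ((cycleFivePendant t).adjMatrix ℝ) ((cycleFivePendant t).isHermitian_adjMatrix ℝ) μ hμ.1
    (by convert hch) p hp f
  have hf0 : x (Sum.inl 0) = 0 := by simpa [f] using congrFun hfx 0
  have hf1 : x (Sum.inl 2) + ε * x (Sum.inl 3) = 0 := by simpa [f] using congrFun hfx 1
  have hle : Real.sqrt 2 * (x ⬝ᵥ x) ≤
      ε * (x ⬝ᵥ (((cycleFivePendant t).adjMatrix ℝ).mulVec x)) := by
    rw [hc1, hc2, Finset.mul_sum, Finset.mul_sum]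
    refine Finset.sum_le_sum fun k _ => ?_
    rw [← mul_assoc]
    exact mul_le_mul_of_nonneg_right (h k) (sq_nonneg _)
  rw [norm_form t ht2, adj_form t ht2] at hle
  have hz : ∀ i : Fin 5, i ≠ 0 → pendVal t x i 1 = 0 := fun i hi =>
    pendVal_zero t x i 1 (ht i hi)
  simp only [Fin.sum_univ_five, hz 1 (by decide), hz 2 (by decide), hz 3 (by decide),
    hz 4 (by decide), hf0, show (0 + 1 : Fin 5) = 1 from rfl, show (1 + 1 : Fin 5) = 2 from rfl,
    show (2 + 1 : Fin 5) = 3 from rfl, show (3 + 1 : Fin 5) = 4 from rfl,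
    show (4 + 1 : Fin 5) = 0 from rfl] at hle
  obtain ⟨h1, h2, h3, h4, k0, k1, k2, k3, k4, l0⟩ := form_bound ε hε (Real.sqrt 2)
    (Real.sq_sqrt (by norm_num)) (by positivity)
    (x (Sum.inl 1)) (x (Sum.inl 2)) (x (Sum.inl 3)) (x (Sum.inl 4))
    (pendVal t x 0 0) (pendVal t x 1 0) (pendVal t x 2 0) (pendVal t x 3 0) (pendVal t x 4 0)
    (pendVal t x 0 1) hf1 (by ring_nf at hle ⊢; exact hle)
  apply hx0
  have hxx : x ⬝ᵥ x = 0 := by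
    rw [norm_form t ht2]
    simp [Fin.sum_univ_five, *]
  exact dotProduct_self_eq_zero.1 hxx

/-- For `G = C₅(t₁,…,t₅)` with `0 ≤ t₁ ≤ 2` and `0 ≤ tᵢ ≤ 1` for
`i = 2,…,5`, the third largest eigenvalue `λ₃(G)` (0-indexed position 2) satisfies
`λ₃(G) < √2` and the third smallest eigenvalue `λ₃⁻(G)` (0-indexed position `n-3`)
satisfies `λ₃⁻(G) > -√2`. -/
theorem cycleFivePendant_third_eigenvalues
    (t : Fin 5 → ℕ) (ht0 : t 0 ≤ 2) (ht : ∀ i : Fin 5, i ≠ 0 → t i ≤ 1)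
    (μ : Fin (Fintype.card ((Fin 5) ⊕ (Σ i : Fin 5, Fin (t i)))) → ℝ)
    (hμ : (cycleFivePendant t).IsEigenvalueSeq μ)
    (a b : Fin (Fintype.card ((Fin 5) ⊕ (Σ i : Fin 5, Fin (t i)))))
    (ha : (a : ℕ) = 2)
    (hb : (b : ℕ) = Fintype.card ((Fin 5) ⊕ (Σ i : Fin 5, Fin (t i))) - 3) :
    μ a < Real.sqrt 2 ∧ -Real.sqrt 2 < μ b := by
  have hcard : 5 ≤ Fintype.card ((Fin 5) ⊕ (Σ i : Fin 5, Fin (t i))) := by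
    simp
  constructor
  · by_contra hcon
    rw [not_lt] at hcon
    refine third_aux t ht0 ht μ hμ (fun k => ⟨k, by omega⟩) ?_ 1 (Or.inl rfl) ?_
    · intro k l hkl
      simpa [Fin.ext_iff] using hkl
    · intro k
      rw [one_mul]
      refine hcon.trans (hμ.1 ?_)
      rw [Fin.le_def]
      have := k.2
      simp only
      omega
  · by_contra hcon
    rw [not_lt] at hcon
    refine third_aux t ht0 ht μ hμ (fun k => ⟨b + k, by omega⟩) ?_ (-1) (Or.inr rfl) ?_
    · intro k l hkl
      simpa [Fin.ext_iff] using hkl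
    · intro k
      have : μ ⟨b + k, by omega⟩ ≤ μ b := hμ.1 (by rw [Fin.le_def]; simp)
      linarith
end

section
/- Let G be a finite simple graph of order n with maximum degree at most 3, none of whose connected components is a path on at most 4 vertices. Then G has at least n/30 eigenvalues (counted with multiplicity) that are greater than or equal to √3. -/
set_option linter.unusedSectionVars false

namespace SubC

variable {V : Type*} [DecidableEq V]

def nb (G : SimpleGraph V) [DecidableRel G.Adj] (U : Finset V) (v : V) : Finset V :=
  U.filter (fun y => G.Adj v y)

def bd (G : SimpleGraph V) [DecidableRel G.Adj] (U S : Finset V) : Finset V :=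
  (U \ S).filter (fun y => ∃ x ∈ S, G.Adj x y)

/-- connected vertex sets, built by adding one adjacent vertex at a time -/
inductive Cn (G : SimpleGraph V) : Finset V → Prop
  | single (v : V) : Cn G {v}
  | ins (S : Finset V) (x y : V) : Cn G S → x ∉ S → y ∈ S → G.Adj y x → Cn G (insert x S)

def Cl (G : SimpleGraph V) (U T : Finset V) : Prop :=
  ∀ x ∈ T, ∀ y ∈ U, G.Adj x y → y ∈ T

/-- the set contains a claw, a path on 5 vertices, a triangle or a 4-cycle -/
def Good (G : SimpleGraph V) (S : Finset V) : Prop :=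
  (∃ a ∈ S, ∃ b ∈ S, ∃ c ∈ S, ∃ d ∈ S, G.Adj a b ∧ G.Adj a c ∧ G.Adj a d ∧
    b ≠ c ∧ b ≠ d ∧ c ≠ d) ∨
  (∃ a ∈ S, ∃ b ∈ S, ∃ c ∈ S, ∃ d ∈ S, ∃ e ∈ S, G.Adj a b ∧ G.Adj b c ∧ G.Adj c d ∧ G.Adj d e ∧
    a ≠ c ∧ a ≠ d ∧ a ≠ e ∧ b ≠ d ∧ b ≠ e ∧ c ≠ e) ∨
  (∃ a ∈ S, ∃ b ∈ S, ∃ c ∈ S, G.Adj a b ∧ G.Adj b c ∧ G.Adj c a) ∨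
  (∃ a ∈ S, ∃ b ∈ S, ∃ c ∈ S, ∃ d ∈ S, G.Adj a b ∧ G.Adj b c ∧ G.Adj c d ∧ G.Adj d a ∧
    a ≠ c ∧ b ≠ d)

theorem Good.mono {G : SimpleGraph V} {S T : Finset V} (h : S ⊆ T) (hS : Good G S) : Good G T := by
  rcases hS with ⟨a, ha, b, hb, c, hc, d, hd, h1⟩ | ⟨a, ha, b, hb, c, hc, d, hd, e, he, h1⟩ |
    ⟨a, ha, b, hb, c, hc, h1⟩ | ⟨a, ha, b, hb, c, hc, d, hd, h1⟩
  · exact Or.inl ⟨a, h ha, b, h hb, c, h hc, d, h hd, h1⟩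
  · exact Or.inr (Or.inl ⟨a, h ha, b, h hb, c, h hc, d, h hd, e, h he, h1⟩)
  · exact Or.inr (Or.inr (Or.inl ⟨a, h ha, b, h hb, c, h hc, h1⟩))
  · exact Or.inr (Or.inr (Or.inr ⟨a, h ha, b, h hb, c, h hc, d, h hd, h1⟩))

theorem Good.nonempty {G : SimpleGraph V} {S : Finset V} (hS : Good G S) : S.Nonempty := by
  rcases hS with ⟨a, ha, _⟩ | ⟨a, ha, _⟩ | ⟨a, ha, _⟩ | ⟨a, ha, _⟩ <;> exact ⟨a, ha⟩

theorem Cn.nonempty {G : SimpleGraph V} {S : Finset V} (hS : Cn G S) : S.Nonempty := by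
  cases hS <;> simp

theorem shape {G : SimpleGraph V} {S : Finset V} (hS : Cn G S) :
    Good G S ∨ (∃ a, S = {a}) ∨ (∃ a b, G.Adj a b ∧ S = {a, b}) ∨
    (∃ a b c, G.Adj a b ∧ G.Adj b c ∧ a ≠ c ∧ S = {a, b, c}) ∨
    (∃ a b c d, G.Adj a b ∧ G.Adj b c ∧ G.Adj c d ∧ a ≠ c ∧ a ≠ d ∧ b ≠ d ∧ S = {a, b, c, d}) := by
  induction hS with
  | single v => exact Or.inr (Or.inl ⟨v, rfl⟩)
  | ins S x y _ hx hy hxy ih =>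
    have hyx := hxy.symm
    rcases ih with h | ⟨a, rfl⟩ | ⟨a, b, hab, rfl⟩ | ⟨a, b, c, hab, hbc, hac, rfl⟩ |
      ⟨a, b, c, d, hab, hbc, hcd, hac, had, hbd, rfl⟩
    · exact Or.inl (h.mono (Finset.subset_insert _ _))
    · simp at hy; subst hy
      exact Or.inr (Or.inr (Or.inl ⟨x, y, hyx, rfl⟩))
    · right; right; right; left
      simp at hx hy
      rcases hy with rfl | rfl
      · exact ⟨x, y, b, hyx, hab, hx.2, rfl⟩
      · exact ⟨x, y, a, hyx, hab.symm, hx.1, by ext; simp; tauto⟩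
    · simp at hx hy
      rcases hy with rfl | rfl | rfl
      · right; right; right; right
        exact ⟨x, y, b, c, hyx, hab, hbc, hx.2.1, hx.2.2, hac, rfl⟩
      · left; left
        refine ⟨y, by simp, x, by simp, a, by simp, c, by simp, hxy, hab.symm, hbc, ?_⟩
        tauto
      · right; right; right; right
        exact ⟨x, y, b, a, hyx, hbc.symm, hab.symm, hx.2.1, hx.1, hac.symm, by ext; simp; tauto⟩
    · simp at hx hy
      left
      rcases hy with rfl | rfl | rfl | rfl
      · right; left
        refine ⟨x, by simp, y, by simp, b, by simp, c, by simp, d, by simp, hyx, hab, hbc, hcd, ?_⟩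
        tauto
      · left
        refine ⟨y, by simp, x, by simp, a, by simp, c, by simp, hxy, hab.symm, hbc, ?_⟩
        tauto
      · left
        refine ⟨y, by simp, x, by simp, b, by simp, d, by simp, hxy, hbc.symm, hcd, ?_⟩
        tauto
      · right; left
        refine ⟨x, by simp, y, by simp, c, by simp, b, by simp, a, by simp, hyx, hcd.symm,
          hbc.symm, hab.symm, ?_⟩
        refine ⟨hx.2.2.1, hx.2.1, hx.1, hbd.symm, had.symm, hac.symm⟩

theorem Cn.card_le {G : SimpleGraph V} {S : Finset V} (hS : Cn G S) (h : ¬ Good G S) :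
    S.card ≤ 4 := by
  rcases shape hS with h' | ⟨a, rfl⟩ | ⟨a, b, _, rfl⟩ | ⟨a, b, c, _, _, _, rfl⟩ |
      ⟨a, b, c, d, _, _, _, _, _, _, rfl⟩
  · exact absurd h' h
  · simp
  · exact Finset.card_le_two.trans (by norm_num)
  · exact Finset.card_le_three.trans (by norm_num)
  · exact Finset.card_le_four

theorem Cn.subset_of_cl {G : SimpleGraph V} {W S T : Finset V} (hS : Cn G S) (hSW : S ⊆ W)
    (hT : Cl G W T) (hne : ∃ x ∈ S, x ∈ T) : S ⊆ T := by
  induction hS with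
  | single v => simpa using hne
  | ins S x y hS hx hy hxy ih =>
    have hSW' : S ⊆ W := (Finset.subset_insert _ _).trans hSW
    have hxW : x ∈ W := hSW (by simp)
    obtain ⟨z, hz, hzT⟩ := hne
    have key : S ⊆ T := by
      rcases Finset.mem_insert.1 hz with rfl | hz
      · exact ih hSW' ⟨y, hy, hT z hzT y (hSW' hy) hxy.symm⟩
      · exact ih hSW' ⟨z, hz, hzT⟩
    exact Finset.insert_subset (hT y (key hy) x hxW hxy) key

section
variable {G : SimpleGraph V} [DecidableRel G.Adj]

theorem mem_nb {U : Finset V} {v y : V} : y ∈ nb G U v ↔ y ∈ U ∧ G.Adj v y := by simp [nb]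

theorem mem_bd {U S : Finset V} {y : V} :
    y ∈ bd G U S ↔ (y ∈ U ∧ y ∉ S) ∧ ∃ x ∈ S, G.Adj x y := by simp [bd]

theorem cl_of_bd {U T : Finset V} (h : bd G U T = ∅) : Cl G U T := by
  intro x hx y hy hxy
  by_contra hyT
  have : y ∈ bd G U T := mem_bd.2 ⟨⟨hy, hyT⟩, x, hx, hxy⟩
  simp [h] at this

theorem nb_erase {U D : Finset V} (hd : ∀ v, (nb G U v).card ≤ 3) {b s : V} (hs : s ∈ U)
    (hbs : G.Adj b s) (hDU : D ⊆ U) (hsD : s ∉ D) : (nb G D b).card ≤ 2 := by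
  have h1 : nb G D b ⊆ (nb G U b).erase s := by
    intro z hz
    rw [mem_nb] at hz
    refine Finset.mem_erase.2 ⟨?_, mem_nb.2 ⟨hDU hz.1, hz.2⟩⟩
    rintro rfl; exact hsD hz.1
  have h2 := Finset.card_le_card h1
  rw [Finset.card_erase_of_mem (mem_nb.2 ⟨hs, hbs⟩)] at h2
  have := hd b
  omega

theorem bd_insert {U T : Finset V} (hd : ∀ v, (nb G U v).card ≤ 3) (hTU : T ⊆ U) {x : V}
    (hx : x ∈ bd G U T) : (bd G U (insert x T)).card ≤ (bd G U T).card + 1 := by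
  obtain ⟨⟨hxU, hxT⟩, y, hy, hyx⟩ := mem_bd.1 hx
  have h1 : bd G U (insert x T) ⊆ (bd G U T).erase x ∪ nb G (U.erase y) x := by
    intro z hz
    obtain ⟨⟨hzU, hzT⟩, w, hw, hwz⟩ := mem_bd.1 hz
    simp only [Finset.mem_insert, not_or] at hzT
    rcases Finset.mem_insert.1 hw with rfl | hw
    · refine Finset.mem_union_right _ (mem_nb.2 ⟨Finset.mem_erase.2 ⟨?_, hzU⟩, hwz⟩)
      rintro rfl; exact hzT.2 hy
    · exact Finset.mem_union_left _ (Finset.mem_erase.2 ⟨hzT.1, mem_bd.2 ⟨⟨hzU, hzT.2⟩, w, hw, hwz⟩⟩)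
  have h2 := (Finset.card_le_card h1).trans (Finset.card_union_le _ _)
  rw [Finset.card_erase_of_mem hx] at h2
  have h3 := nb_erase (D := U.erase y) hd (hTU hy) hyx.symm (Finset.erase_subset _ _) (by simp)
  have h4 : 0 < (bd G U T).card := Finset.card_pos.2 ⟨x, hx⟩
  omega

theorem grow {U : Finset V} (hd : ∀ v, (nb G U v).card ≤ 3)
    (hU : ∀ T ⊆ U, Cn G T → Cl G U T → Good G T) (t : ℕ) : ∀ T ⊆ U, Cn G T → T.card + t = 5 →
    ∃ S ⊆ U, S.card ≤ 5 ∧ Good G S ∧ (bd G U S).card ≤ (bd G U T).card + t := by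
  induction t with
  | zero =>
    intro T hT hc h5
    refine ⟨T, hT, by omega, ?_, le_rfl⟩
    by_contra hg
    have := hc.card_le hg
    omega
  | succ t ih =>
    intro T hT hc h5
    rcases Finset.eq_empty_or_nonempty (bd G U T) with he | ⟨x, hx⟩
    · exact ⟨T, hT, by omega, hU T hT hc (cl_of_bd he), by omega⟩
    · obtain ⟨⟨hxU, hxT⟩, y, hy, hyx⟩ := mem_bd.1 hx
      obtain ⟨S, h1, h2, h3, h4⟩ := ih (insert x T) (Finset.insert_subset hxU hT)
        (Cn.ins T x y hc hxT hy hyx) (by rw [Finset.card_insert_of_notMem hxT]; omega)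
      have := bd_insert hd hT hx
      exact ⟨S, h1, h2, h3, by omega⟩

theorem start {U : Finset V} (hd : ∀ v, (nb G U v).card ≤ 3)
    (hU : ∀ T ⊆ U, Cn G T → Cl G U T → Good G T) (hne : U.Nonempty) :
    ∃ S ⊆ U, S.card ≤ 5 ∧ Good G S ∧ (bd G U S).card ≤ 6 := by
  obtain ⟨u, hu⟩ := hne
  by_cases h : (nb G U u).card ≤ 2
  · obtain ⟨S, h1, h2, h3, h4⟩ := grow hd hU 4 {u} (by simpa using hu) (Cn.single u) (by simp)
    refine ⟨S, h1, h2, h3, ?_⟩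
    have : bd G U {u} ⊆ nb G U u := by
      intro z hz
      obtain ⟨⟨hzU, hzT⟩, w, hw, hwz⟩ := mem_bd.1 hz
      simp at hw; subst hw
      exact mem_nb.2 ⟨hzU, hwz⟩
    have := Finset.card_le_card this
    omega
  · have h3 : (nb G U u).card = 3 := by have := hd u; omega
    obtain ⟨a, b, c, hab, hac, hbc, hn⟩ := Finset.card_eq_three.1 h3
    have ha : a ∈ nb G U u := by simp [hn]
    have hb : b ∈ nb G U u := by simp [hn]
    have hc : c ∈ nb G U u := by simp [hn]
    rw [mem_nb] at ha hb hc
    refine ⟨{u, a, b, c}, ?_, Finset.card_le_four.trans (by norm_num), ?_, ?_⟩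
    · intro z; simp; rintro (rfl | rfl | rfl | rfl) <;> tauto
    · left
      exact ⟨u, by simp, a, by simp, b, by simp, c, by simp, ha.2, hb.2, hc.2, hab, hac, hbc⟩
    · have h1 : bd G U {u, a, b, c} ⊆
          nb G (U.erase u) a ∪ (nb G (U.erase u) b ∪ nb G (U.erase u) c) := by
        intro z hz
        obtain ⟨⟨hzU, hzT⟩, w, hw, hwz⟩ := mem_bd.1 hz
        simp only [Finset.mem_insert, Finset.mem_singleton, not_or] at hzT hw
        simp only [Finset.mem_union, mem_nb, Finset.mem_erase]
        rcases hw with rfl | rfl | rfl | rfl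
        · have : z ∈ nb G U w := mem_nb.2 ⟨hzU, hwz⟩
          rw [hn] at this; simp at this; tauto
        all_goals tauto
      have h2 := (Finset.card_le_card h1).trans (Finset.card_union_le _ _)
      have h4 := Finset.card_union_le (nb G (U.erase u) b) (nb G (U.erase u) c)
      have e1 := nb_erase (D := U.erase u) hd hu ha.2.symm (Finset.erase_subset _ _) (by simp)
      have e2 := nb_erase (D := U.erase u) hd hu hb.2.symm (Finset.erase_subset _ _) (by simp)
      have e3 := nb_erase (D := U.erase u) hd hu hc.2.symm (Finset.erase_subset _ _) (by simp)
      omega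

theorem start_min {U : Finset V} (hd : ∀ v, (nb G U v).card ≤ 3)
    (hU : ∀ T ⊆ U, Cn G T → Cl G U T → Good G T) (hne : U.Nonempty) :
    ∃ S ⊆ U, S.card ≤ 5 ∧ Good G S ∧ (bd G U S).card ≤ 6 ∧
      ∀ S' ⊆ U, S'.card ≤ 5 → Good G S' → (bd G U S).card ≤ (bd G U S').card := by
  classical
  obtain ⟨S, h1, h2, h3, h4⟩ := start hd hU hne
  obtain ⟨S0, hS0, hmin⟩ := Finset.exists_min_image
    (U.powerset.filter (fun S => S.card ≤ 5 ∧ Good G S)) (fun S => (bd G U S).card)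
    ⟨S, by simp [h1, h2, h3]⟩
  simp only [Finset.mem_filter, Finset.mem_powerset] at hS0 hmin
  exact ⟨S0, hS0.1, hS0.2.1, hS0.2.2, (hmin S ⟨h1, h2, h3⟩).trans h4,
    fun S' a b c => hmin S' ⟨a, b, c⟩⟩

theorem step {U : Finset V} (hd : ∀ v, (nb G U v).card ≤ 3)
    (hU : ∀ T ⊆ U, Cn G T → Cl G U T → Good G T) (hne : U.Nonempty) :
    ∃ S ⊆ U, Good G S ∧ ∃ U' ⊆ U, (∀ T ⊆ U', Cn G T → Cl G U' T → Good G T) ∧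
      (∀ x ∈ S, ∀ y ∈ U', x ≠ y ∧ ¬ G.Adj x y) ∧ U.card ≤ U'.card + 30 := by
  classical
  obtain ⟨S, hSU, hS5, hSg, hm6, hmin⟩ := start_min hd hU hne
  set N := bd G U S with hN
  set W := U \ (S ∪ N) with hW
  set B := W.powerset.filter (fun C => Cn G C ∧ Cl G W C ∧ ¬ Good G C) with hB
  set D := B.biUnion id with hD
  have memB : ∀ C, C ∈ B ↔ C ⊆ W ∧ Cn G C ∧ Cl G W C ∧ ¬ Good G C := by
    intro C; simp [hB]
  have hWU : W ⊆ U := Finset.sdiff_subset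
  have hDW : D ⊆ W := by
    intro z hz
    obtain ⟨C, hC, hzC⟩ := Finset.mem_biUnion.1 hz
    exact ((memB C).1 hC).1 hzC
  have hNU : N ⊆ U := fun z hz => (mem_bd.1 hz).1.1
  have hdisj : (B : Set (Finset V)).PairwiseDisjoint id := by
    intro C hC C' hC' hne
    rw [Function.onFun, Finset.disjoint_left]
    intro z hz hz'
    obtain ⟨a1, a2, a3, a4⟩ := (memB C).1 hC
    obtain ⟨b1, b2, b3, b4⟩ := (memB C').1 hC'
    exact hne (Finset.Subset.antisymm (a2.subset_of_cl a1 b3 ⟨z, hz, hz'⟩)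
      (b2.subset_of_cl b1 a3 ⟨z, hz', hz⟩))
  have hbdC : ∀ C ∈ B, bd G U C ⊆ N := by
    intro C hC z hz
    obtain ⟨a1, a2, a3, a4⟩ := (memB C).1 hC
    obtain ⟨⟨hzU, hzC⟩, x, hx, hxz⟩ := mem_bd.1 hz
    by_contra hzN
    have hxW := a1 hx
    rw [hW] at hxW
    simp only [Finset.mem_sdiff, Finset.mem_union, not_or] at hxW
    by_cases hzS : z ∈ S
    · exact hxW.2.2 (mem_bd.2 ⟨⟨hxW.1, hxW.2.1⟩, z, hzS, hxz.symm⟩)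
    · exact hzC (a3 x hx z (by simp [hW, hzU, hzS, hzN]) hxz)
  have hcount : ∑ C ∈ B, (bd G U C).card ≤ 2 * N.card := by
    calc ∑ C ∈ B, (bd G U C).card ≤ ∑ C ∈ B, ∑ x ∈ C, (nb G N x).card := by
          refine Finset.sum_le_sum fun C hC => ?_
          have : bd G U C ⊆ C.biUnion (nb G N) := by
            intro z hz
            obtain ⟨⟨hzU, hzC⟩, x, hx, hxz⟩ := mem_bd.1 hz
            exact Finset.mem_biUnion.2 ⟨x, hx, mem_nb.2 ⟨hbdC C hC hz, hxz⟩⟩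
          exact (Finset.card_le_card this).trans Finset.card_biUnion_le
      _ = ∑ x ∈ D, (nb G N x).card := (Finset.sum_biUnion hdisj).symm
      _ = ∑ x ∈ D, ∑ b ∈ N, if G.Adj x b then 1 else 0 := by simp [nb]
      _ = ∑ b ∈ N, ∑ x ∈ D, if G.Adj x b then 1 else 0 := Finset.sum_comm
      _ = ∑ b ∈ N, (nb G D b).card := by simp [nb, G.adj_comm]
      _ ≤ ∑ b ∈ N, 2 := by
          refine Finset.sum_le_sum fun b hb => ?_
          obtain ⟨_, s, hs, hsb⟩ := mem_bd.1 hb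
          refine nb_erase hd (hSU hs) hsb.symm (hDW.trans hWU) ?_
          intro hsD
          have := hDW hsD
          simp [hW, hs] at this
      _ = 2 * N.card := by simp [mul_comm]
  have hDcard : D.card ≤ ∑ C ∈ B, C.card := Finset.card_biUnion_le
  have hloc : ∀ C ∈ B, C.card ≤ 4 ∧ 1 ≤ (bd G U C).card ∧
      N.card + C.card ≤ (bd G U C).card + 5 := by
    intro C hC
    obtain ⟨a1, a2, a3, a4⟩ := (memB C).1 hC
    have c4 := a2.card_le a4
    refine ⟨c4, ?_, ?_⟩
    · rw [Nat.one_le_iff_ne_zero, Ne, Finset.card_eq_zero]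
      intro h0
      exact a4 (hU C (a1.trans hWU) a2 (cl_of_bd h0))
    · obtain ⟨S', h1, h2, h3, h4⟩ := grow hd hU (5 - C.card) C (a1.trans hWU) a2 (by omega)
      have := hmin S' h1 h2 h3
      omega
  have hD2 : ∀ c : ℕ, (∀ C ∈ B, 2 * C.card ≤ c * (bd G U C).card) → D.card ≤ c * N.card := by
    intro c hc
    have h1 : ∑ C ∈ B, 2 * C.card ≤ ∑ C ∈ B, c * (bd G U C).card := Finset.sum_le_sum hc
    rw [← Finset.mul_sum, ← Finset.mul_sum] at h1
    have h2 := Nat.mul_le_mul_left c hcount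
    have h3 : c * (2 * N.card) = 2 * (c * N.card) := by ring
    omega
  have hDfin : N.card + D.card ≤ 25 := by
    have hc : N.card ≤ 2 ∨ N.card = 3 ∨ N.card = 4 ∨ N.card = 5 ∨ N.card = 6 := by omega
    rcases hc with h | h | h | h | h
    · have := hD2 8 (fun C hC => by have := hloc C hC; omega)
      omega
    · have := hD2 6 (fun C hC => by have := hloc C hC; omega)
      omega
    · have := hD2 4 (fun C hC => by have := hloc C hC; omega)
      omega
    · have := hD2 4 (fun C hC => by have := hloc C hC; omega)
      omega
    · have := hD2 3 (fun C hC => by have := hloc C hC; omega)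
      omega
  refine ⟨S, hSU, hSg, W \ D, Finset.sdiff_subset.trans hWU, ?_, ?_, ?_⟩
  · intro T hT hTc hTcl
    by_contra hTg
    have hTB : T ∈ B := by
      refine (memB T).2 ⟨hT.trans Finset.sdiff_subset, hTc, ?_, hTg⟩
      intro x hx y hy hxy
      by_cases hyD : y ∈ D
      · exfalso
        obtain ⟨C, hC, hyC⟩ := Finset.mem_biUnion.1 hyD
        have hxW := Finset.mem_sdiff.1 (hT hx)
        exact hxW.2 (Finset.mem_biUnion.2
          ⟨C, hC, ((memB C).1 hC).2.2.1 y hyC x hxW.1 hxy.symm⟩)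
      · exact hTcl x hx y (Finset.mem_sdiff.2 ⟨hy, hyD⟩) hxy
    obtain ⟨z, hz⟩ := hTc.nonempty
    exact (Finset.mem_sdiff.1 (hT hz)).2 (Finset.mem_biUnion.2 ⟨T, hTB, hz⟩)
  · intro x hx y hy
    have hyW := (Finset.mem_sdiff.1 hy).1
    rw [hW] at hyW
    simp only [Finset.mem_sdiff, Finset.mem_union, not_or] at hyW
    refine ⟨?_, fun hxy => hyW.2.2 (mem_bd.2 ⟨⟨hyW.1, hyW.2.1⟩, x, hx, hxy⟩)⟩
    rintro rfl; exact hyW.2.1 hx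
  · have h1 := Finset.le_card_sdiff D W
    have h2 := Finset.le_card_sdiff (S ∪ N) U
    have h3 := Finset.card_union_le S N
    rw [← hW] at h2
    omega

theorem pack (U : Finset V) : (∀ v, (nb G U v).card ≤ 3) →
    (∀ T ⊆ U, Cn G T → Cl G U T → Good G T) →
    ∃ F : Finset (Finset V), (∀ S ∈ F, S ⊆ U ∧ Good G S) ∧
      (∀ S ∈ F, ∀ T ∈ F, S ≠ T → ∀ x ∈ S, ∀ y ∈ T, x ≠ y ∧ ¬ G.Adj x y) ∧
      U.card ≤ 30 * F.card := by
  induction U using Finset.strongInduction with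
  | H U ih =>
    intro hd hU
    rcases Finset.eq_empty_or_nonempty U with rfl | hne
    · exact ⟨∅, by simp, by simp, by simp⟩
    obtain ⟨S, hSU, hSg, U', hU', hH, hsep, hcard⟩ := step hd hU hne
    obtain ⟨s, hs⟩ := hSg.nonempty
    have hss : U' ⊂ U := by
      refine Finset.ssubset_iff_subset_ne.2 ⟨hU', ?_⟩
      rintro rfl
      exact (hsep s hs s (hSU hs)).1 rfl
    obtain ⟨F, h1, h2, h3⟩ := ih U' hss (fun v => (Finset.card_le_card
      (Finset.filter_subset_filter _ hU')).trans (hd v)) hH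
    have hSF : S ∉ F := fun h => (hsep s hs s ((h1 S h).1 hs)).1 rfl
    refine ⟨insert S F, ?_, ?_, ?_⟩
    · intro T hT
      rcases Finset.mem_insert.1 hT with rfl | hT
      · exact ⟨hSU, hSg⟩
      · exact ⟨(h1 T hT).1.trans hU', (h1 T hT).2⟩
    · intro A hA B hB hAB x hx y hy
      rcases Finset.mem_insert.1 hA with rfl | hA2 <;> rcases Finset.mem_insert.1 hB with rfl | hB2
      · exact absurd rfl hAB
      · exact hsep x hx y ((h1 B hB2).1 hy)
      · have := hsep y hy x ((h1 A hA2).1 hx)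
        exact ⟨this.1.symm, fun h => this.2 h.symm⟩
      · exact h2 A hA2 B hB2 hAB x hx y hy
    · rw [Finset.card_insert_of_notMem hSF]; omega

end

/-- Interlacing-type bound. -/
theorem interlace {n κ : Type*} [Fintype n] [DecidableEq n] [Fintype κ] [DecidableEq κ]
    (A : Matrix n n ℝ) (hA : A.IsHermitian) (r : ℝ) (f : κ → n → ℝ)
    (hpos : ∀ i, 0 < f i ⬝ᵥ f i) (hform : ∀ i, r * (f i ⬝ᵥ f i) ≤ f i ⬝ᵥ (A.mulVec (f i)))
    (horth : ∀ i j, i ≠ j → f i ⬝ᵥ f j = 0)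
    (hAorth : ∀ i j, i ≠ j → f i ⬝ᵥ (A.mulVec (f j)) = 0) :
    Fintype.card κ ≤ Fintype.card {j // r ≤ hA.eigenvalues j} := by
  let u := hA.eigenvectorBasis
  let L : (κ → ℝ) →ₗ[ℝ] ({j // r ≤ hA.eigenvalues j} → ℝ) :=
    { toFun := fun c j => (u j : EuclideanSpace ℝ n).ofLp ⬝ᵥ (∑ i, c i • f i)
      map_add' := by
        intro c d; ext j
        simp [add_smul, Finset.sum_add_distrib, dotProduct_add]
      map_smul' := by
        intro a c; ext j
        simp [mul_smul, ← Finset.smul_sum, dotProduct_smul] }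
  have hinj : Function.Injective L := by
    rw [injective_iff_map_eq_zero]
    intro c hc
    by_contra hne
    set v : n → ℝ := ∑ i, c i • f i with hv
    have hLj : ∀ j, r ≤ hA.eigenvalues j → (u j).ofLp ⬝ᵥ v = 0 := fun j hj => congrFun hc ⟨j, hj⟩
    have hvv : v ⬝ᵥ v = ∑ i, c i ^ 2 * (f i ⬝ᵥ f i) := by
      rw [hv, sum_dotProduct]
      refine Finset.sum_congr rfl fun i _ => ?_
      rw [dotProduct_sum, Finset.sum_eq_single i]
      · simp; ring
      · intro j _ hj; simp [horth i j hj.symm]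
      · simp
    have hvA : v ⬝ᵥ (A.mulVec v) = ∑ i, c i ^ 2 * (f i ⬝ᵥ (A.mulVec (f i))) := by
      rw [hv, sum_dotProduct]
      refine Finset.sum_congr rfl fun i _ => ?_
      rw [Matrix.mulVec_sum, dotProduct_sum, Finset.sum_eq_single i]
      · simp [Matrix.mulVec_smul]; ring
      · intro j _ hj; simp [Matrix.mulVec_smul, hAorth i j hj.symm]
      · simp
    have h1 : r * (v ⬝ᵥ v) ≤ v ⬝ᵥ (A.mulVec v) := by
      rw [hvv, hvA, Finset.mul_sum]
      refine Finset.sum_le_sum fun i _ => ?_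
      nlinarith [hform i, sq_nonneg (c i), mul_le_mul_of_nonneg_left (hform i) (sq_nonneg (c i))]
    have h2 : 0 < v ⬝ᵥ v := by
      obtain ⟨i, hi⟩ := Function.ne_iff.1 hne
      rw [hvv]
      exact Finset.sum_pos' (fun i _ => mul_nonneg (sq_nonneg _) (hpos i).le)
        ⟨i, Finset.mem_univ _, mul_pos (sq_pos_of_ne_zero hi) (hpos i)⟩
    have pars : ∀ x y : n → ℝ, x ⬝ᵥ y = ∑ j, ((u j).ofLp ⬝ᵥ x) * ((u j).ofLp ⬝ᵥ y) := by
      intro x y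
      have := u.sum_inner_mul_inner (WithLp.toLp 2 x) (WithLp.toLp 2 y)
      simp only [EuclideanSpace.inner_eq_star_dotProduct, star_trivial] at this
      rw [dotProduct_comm x y, ← this]
      refine Finset.sum_congr rfl fun j _ => ?_
      rw [dotProduct_comm y]
    have heig : ∀ j, (u j).ofLp ⬝ᵥ (A.mulVec v) = hA.eigenvalues j * ((u j).ofLp ⬝ᵥ v) := by
      intro j
      have h3 := hA.mulVec_eigenvectorBasis j
      have hT : A.transpose = A := by
        have h5 := hA.eq
        rwa [Matrix.conjTranspose_eq_transpose_of_trivial] at h5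
      rw [Matrix.dotProduct_mulVec, ← Matrix.mulVec_transpose, hT, h3, smul_dotProduct, smul_eq_mul]
    have h4 : v ⬝ᵥ (A.mulVec v) < r * (v ⬝ᵥ v) := by
      rw [pars v (A.mulVec v)]
      rw [pars v v] at h2 ⊢
      rw [Finset.mul_sum]
      obtain ⟨j, -, hj⟩ := Finset.exists_ne_zero_of_sum_ne_zero h2.ne'
      have hj0 : (u j).ofLp ⬝ᵥ v ≠ 0 := fun h => hj (by simp [h])
      refine Finset.sum_lt_sum (fun k _ => ?_) ⟨j, Finset.mem_univ _, ?_⟩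
      · rw [heig]
        by_cases hk : r ≤ hA.eigenvalues k
        · simp [hLj k hk]
        · push Not at hk
          nlinarith [mul_self_nonneg ((u k).ofLp ⬝ᵥ v)]
      · rw [heig]
        have hk : hA.eigenvalues j < r := by
          by_contra h; push Not at h; exact hj0 (hLj j h)
        nlinarith [mul_self_pos.2 hj0]
    linarith
  have := LinearMap.finrank_le_finrank_of_injective hinj
  simpa using this

theorem count_eq {n : Type*} [Fintype n] [DecidableEq n] {m : Type*} [Fintype m]
    (A : Matrix n n ℝ) (hA : A.IsHermitian) (r : ℝ) (μ : m → ℝ)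
    (h : A.charpoly = ∏ i, (Polynomial.X - Polynomial.C (μ i))) :
    Fintype.card {j // r ≤ hA.eigenvalues j} = {i | r ≤ μ i}.ncard := by
  classical
  have h1 := hA.charpoly_eq
  rw [h] at h1
  have h2 := congrArg Polynomial.roots h1
  have key2 : (∏ i, (Polynomial.X - Polynomial.C (μ i))).roots = Finset.univ.val.map μ := by
    have := Polynomial.roots_multiset_prod_X_sub_C (Finset.univ.val.map μ)
    rw [Multiset.map_map] at this
    exact this
  have key3 : (∏ i, (Polynomial.X - Polynomial.C (hA.eigenvalues i))).roots
      = Finset.univ.val.map hA.eigenvalues := by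
    have := Polynomial.roots_multiset_prod_X_sub_C (Finset.univ.val.map hA.eigenvalues)
    rw [Multiset.map_map] at this
    exact this
  have h3 : Finset.univ.val.map μ = Finset.univ.val.map hA.eigenvalues := by
    rw [← key2, ← key3]; exact h2
  have h4 := congrArg (Multiset.countP (fun x => r ≤ x)) h3
  rw [Multiset.countP_map, Multiset.countP_map] at h4
  rw [Fintype.card_subtype, Set.ncard_eq_toFinset_card']
  simp only [Set.toFinset_ofPred]
  exact h4.symm

section
variable {V : Type*} [DecidableEq V]

theorem vec_of_emb [Fintype V] (G : SimpleGraph V) [DecidableRel G.Adj] {k : ℕ} (S : Finset V)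
    (p : Fin k → V) (hp : Function.Injective p) (hpS : ∀ i, p i ∈ S) (g : Fin k → ℝ)
    (hg : ∀ i, 0 ≤ g i) (w : Fin k → Fin k → Bool)
    (hw : ∀ i j, w i j = true → G.Adj (p i) (p j)) (h0 : 0 < ∑ i, g i * g i)
    (h : √3 * ∑ i, g i * g i ≤ ∑ i, ∑ j, g i * ((if w i j then 1 else 0) * g j)) :
    ∃ f : V → ℝ, (∀ x, x ∉ S → f x = 0) ∧ 0 < f ⬝ᵥ f ∧
      √3 * (f ⬝ᵥ f) ≤ f ⬝ᵥ ((G.adjMatrix ℝ).mulVec f) := by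
  have hf : ∀ i, Function.extend p g 0 (p i) = g i := fun i => hp.extend_apply g 0 i
  have hf0 : ∀ x, x ∉ Set.range p → Function.extend p g 0 x = 0 := by
    intro x hx
    rw [Function.extend_apply' _ _ _ (by simpa using hx)]; rfl
  have e1 : Function.extend p g 0 ⬝ᵥ Function.extend p g 0 = ∑ i, g i * g i := by
    symm
    refine Fintype.sum_of_injective p hp _ _ ?_ ?_
    · intro x hx; simp [hf0 x hx]
    · intro i; simp [hf]
  have e2 : Function.extend p g 0 ⬝ᵥ ((G.adjMatrix ℝ).mulVec (Function.extend p g 0)) =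
      ∑ i, g i * ∑ j, (G.adjMatrix ℝ (p i) (p j)) * g j := by
    symm
    refine Fintype.sum_of_injective p hp _ _ ?_ ?_
    · intro x hx; simp [hf0 x hx]
    · intro i
      rw [hf]
      congr 1
      refine Fintype.sum_of_injective p hp _ _ ?_ ?_
      · intro x hx; simp [hf0 x hx]
      · intro j; simp [hf]
  refine ⟨Function.extend p g 0, ?_, by rw [e1]; exact h0, ?_⟩
  · intro x hx
    refine hf0 x ?_
    rintro ⟨i, rfl⟩; exact hx (hpS i)
  · rw [e1, e2]
    refine h.trans (Finset.sum_le_sum fun i _ => ?_)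
    rw [Finset.mul_sum]
    refine Finset.sum_le_sum fun j _ => ?_
    refine mul_le_mul_of_nonneg_left (mul_le_mul_of_nonneg_right ?_ (hg j)) (hg i)
    by_cases hij : w i j = true
    · simp [hij, hw i j hij]
    · simp only [hij, SimpleGraph.adjMatrix_apply]
      split_ifs <;> simp_all
end

section
variable {V : Type*} [DecidableEq V]

theorem good_vec [Fintype V] (G : SimpleGraph V) [DecidableRel G.Adj] (S : Finset V)
    (h : Good G S) : ∃ f : V → ℝ, (∀ x, x ∉ S → f x = 0) ∧ 0 < f ⬝ᵥ f ∧
      √3 * (f ⬝ᵥ f) ≤ f ⬝ᵥ ((G.adjMatrix ℝ).mulVec f) := by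
  have h3 : √3 * √3 = (3 : ℝ) := Real.mul_self_sqrt (by norm_num)
  have h30 : 0 ≤ √(3 : ℝ) := Real.sqrt_nonneg 3
  have h32 : √(3 : ℝ) ≤ 2 := by nlinarith
  rcases h with ⟨a, ha, b, hb, c, hc, d, hd, hab, hac, had, n1, n2, n3⟩ |
    ⟨a, ha, b, hb, c, hc, d, hd, e, he, hab, hbc, hcd, hde, n1, n2, n3, n4, n5, n6⟩ |
    ⟨a, ha, b, hb, c, hc, hab, hbc, hca⟩ | ⟨a, ha, b, hb, c, hc, d, hd, hab, hbc, hcd, hda, n1, n2⟩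
  · refine vec_of_emb G S ![a, b, c, d] ?_ ?_ ![√3, 1, 1, 1] ?_
      (fun i j => (i == 0 && j != 0) || (i != 0 && j == 0)) ?_ ?_ ?_
    · have := hab.ne; have := hac.ne; have := had.ne
      intro i j hij
      fin_cases i <;> fin_cases j <;> simp_all
    · intro i; fin_cases i <;> simp [*]
    · intro i; fin_cases i <;> simp
    · intro i j; fin_cases i <;> fin_cases j <;> simp [hab, hac, had, hab.symm, hac.symm, had.symm]
    · simp [Fin.sum_univ_succ, h3]; norm_num
    · simp [Fin.sum_univ_succ, h3]; nlinarith
  · refine vec_of_emb G S ![a, b, c, d, e] ?_ ?_ ![1, √3, 2, √3, 1] ?_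
      (fun i j => (i.1 + 1 == j.1) || (j.1 + 1 == i.1)) ?_ ?_ ?_
    · have := hab.ne; have := hbc.ne; have := hcd.ne; have := hde.ne
      intro i j hij
      fin_cases i <;> fin_cases j <;> simp_all
    · intro i; fin_cases i <;> simp [*]
    · intro i; fin_cases i <;> simp
    · intro i j; fin_cases i <;> fin_cases j <;>
        simp [hab, hbc, hcd, hde, hab.symm, hbc.symm, hcd.symm, hde.symm]
    · simp [Fin.sum_univ_succ, h3]; norm_num
    · simp [Fin.sum_univ_succ, h3]; nlinarith
  · refine vec_of_emb G S ![a, b, c] ?_ ?_ ![1, 1, 1] ?_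
      (fun i j => i != j) ?_ ?_ ?_
    · have := hab.ne; have := hbc.ne; have := hca.ne
      intro i j hij
      fin_cases i <;> fin_cases j <;> simp_all
    · intro i; fin_cases i <;> simp [*]
    · intro i; fin_cases i <;> simp
    · intro i j; fin_cases i <;> fin_cases j <;>
        simp [hab, hbc, hca, hab.symm, hbc.symm, hca.symm]
    · simp [Fin.sum_univ_succ]; norm_num
    · simp [Fin.sum_univ_succ]; nlinarith
  · refine vec_of_emb G S ![a, b, c, d] ?_ ?_ ![1, 1, 1, 1] ?_
      (fun i j => (i + 1 == j) || (j + 1 == i)) ?_ ?_ ?_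
    · have := hab.ne; have := hbc.ne; have := hcd.ne; have := hda.ne
      intro i j hij
      fin_cases i <;> fin_cases j <;> simp_all
    · intro i; fin_cases i <;> simp [*]
    · intro i; fin_cases i <;> simp
    · intro i j; fin_cases i <;> fin_cases j <;>
        simp [hab, hbc, hcd, hda, hab.symm, hbc.symm, hcd.symm, hda.symm]
    · simp [Fin.sum_univ_succ]; norm_num
    · simp [Fin.sum_univ_succ]; nlinarith

theorem iso_of_emb (G : SimpleGraph V) {k : ℕ} (s : Set V) (p : Fin k → V)
    (hp : Function.Injective p) (hs : Set.range p = s)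
    (h : ∀ i j, G.Adj (p i) (p j) ↔ (SimpleGraph.pathGraph k).Adj i j) :
    Nonempty (G.induce s ≃g SimpleGraph.pathGraph k) := by
  subst hs
  refine ⟨SimpleGraph.Iso.symm ⟨Equiv.ofInjective p hp, ?_⟩⟩
  intro i j
  simpa using h i j

theorem cn_supp {G : SimpleGraph V} {T : Finset V} (hT : Cn G T) [Fintype V]
    (hcl : Cl G Finset.univ T) : ∃ c : G.ConnectedComponent, c.supp = (T : Set V) := by
  have h1 : ∀ x ∈ T, ∀ y ∈ T, G.Reachable x y := by
    clear hcl
    induction hT with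
    | single v => intro x hx y hy; simp at hx hy; subst hx; subst hy; exact SimpleGraph.Reachable.refl _
    | ins S x y _ _ hy hyx ih =>
      have key : ∀ z ∈ insert x S, G.Reachable y z := by
        intro z hz
        rcases Finset.mem_insert.1 hz with rfl | hz
        · exact hyx.reachable
        · exact ih y hy z hz
      intro a ha b hb
      exact (key a ha).symm.trans (key b hb)
  obtain ⟨v, hv⟩ := hT.nonempty
  refine ⟨G.connectedComponentMk v, ?_⟩
  ext z
  rw [SimpleGraph.ConnectedComponent.mem_supp_iff, SimpleGraph.ConnectedComponent.eq]
  constructor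
  · intro h
    obtain ⟨w⟩ := h.symm
    have : ∀ {a b : V} (w : G.Walk a b), a ∈ T → b ∈ T := by
      intro a b w
      induction w with
      | nil => exact id
      | cons hadj _ ih => intro ha; exact ih (hcl _ ha _ (Finset.mem_univ _) hadj)
    exact this w hv
  · intro h
    exact h1 z h v hv

theorem path_of_bad {G : SimpleGraph V} {T : Finset V} (hT : Cn G T) (hg : ¬ Good G T) :
    ∃ m : ℕ, m ≤ 4 ∧ Nonempty (G.induce (T : Set V) ≃g SimpleGraph.pathGraph m) := by
  have tri : ∀ a ∈ T, ∀ b ∈ T, ∀ c ∈ T, G.Adj a b → G.Adj b c → ¬ G.Adj a c := by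
    intro a ha b hb c hc h1 h2 h3
    exact hg (Or.inr (Or.inr (Or.inl ⟨a, ha, b, hb, c, hc, h1, h2, h3.symm⟩)))
  rcases shape hT with h' | ⟨a, rfl⟩ | ⟨a, b, hab, rfl⟩ | ⟨a, b, c, hab, hbc, hac, rfl⟩ |
      ⟨a, b, c, d, hab, hbc, hcd, hac, had, hbd, rfl⟩
  · exact absurd h' hg
  · refine ⟨1, by norm_num, iso_of_emb G _ ![a] (Function.injective_of_subsingleton _) (by simp) ?_⟩
    intro i j; fin_cases i; fin_cases j; simp
  · have := hab.ne
    refine ⟨2, by norm_num, iso_of_emb G _ ![a, b] ?_ ?_ ?_⟩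
    · intro i j hij; fin_cases i <;> fin_cases j <;> simp_all
    · ext z; simp; tauto
    · intro i j; fin_cases i <;> fin_cases j <;>
        simp [SimpleGraph.pathGraph_adj, hab, hab.symm]
  · have := hab.ne; have := hbc.ne
    have t1 := tri a (by simp) b (by simp) c (by simp) hab hbc
    have t1' : ¬ G.Adj c a := fun h => t1 h.symm
    refine ⟨3, by norm_num, iso_of_emb G _ ![a, b, c] ?_ ?_ ?_⟩
    · intro i j hij; fin_cases i <;> fin_cases j <;> simp_all
    · ext z; simp; tauto
    · intro i j; fin_cases i <;> fin_cases j <;>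
        simp [SimpleGraph.pathGraph_adj, hab, hab.symm, hbc, hbc.symm, t1, t1']
  · have := hab.ne; have := hbc.ne; have := hcd.ne
    have t1 := tri a (by simp) b (by simp) c (by simp) hab hbc
    have t1' : ¬ G.Adj c a := fun h => t1 h.symm
    have t2 := tri b (by simp) c (by simp) d (by simp) hbc hcd
    have t2' : ¬ G.Adj d b := fun h => t2 h.symm
    have t3' : ¬ G.Adj d a := fun h => hg (Or.inr (Or.inr (Or.inr
      ⟨a, by simp, b, by simp, c, by simp, d, by simp, hab, hbc, hcd, h, hac, hbd⟩)))
    have t3 : ¬ G.Adj a d := fun h => t3' h.symm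
    refine ⟨4, by norm_num, iso_of_emb G _ ![a, b, c, d] ?_ ?_ ?_⟩
    · clear tri
      intro i j hij; fin_cases i <;> fin_cases j <;> simp_all
    · ext z; simp; tauto
    · intro i j; fin_cases i <;> fin_cases j <;>
        simp [SimpleGraph.pathGraph_adj, hab, hab.symm, hbc, hbc.symm, hcd, hcd.symm,
          t1, t1', t2, t2', t3, t3']

end
end SubC


/-- If `G` is a graph of order `n` with maximum degree at most 3, none
of whose connected components is a path on at most 4 vertices, then at least `n/30`
of its eigenvalues (with multiplicity) are greater than or equal to `√3`. -/
theorem subcubic_many_eigenvalues_ge_sqrt_three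
    {V : Type*} [Fintype V] [DecidableEq V] (G : SimpleGraph V) [DecidableRel G.Adj]
    (hdeg : ∀ v : V, G.degree v ≤ 3)
    (hcomp : ∀ c : G.ConnectedComponent,
      ¬ ∃ m : ℕ, m ≤ 4 ∧ Nonempty (G.induce c.supp ≃g SimpleGraph.pathGraph m))
    (μ : Fin (Fintype.card V) → ℝ) (hμ : G.IsEigenvalueSeq μ) :
    (Fintype.card V : ℝ) / 30 ≤
      (({i : Fin (Fintype.card V) | Real.sqrt 3 ≤ μ i}.ncard : ℕ) : ℝ) := by
  have hgood : ∀ T ⊆ (Finset.univ : Finset V), SubC.Cn G T → SubC.Cl G Finset.univ T →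
      SubC.Good G T := by
    intro T _ hT hcl
    by_contra hg
    obtain ⟨c, hc⟩ := SubC.cn_supp hT hcl
    refine hcomp c ?_
    rw [hc]
    exact SubC.path_of_bad hT hg
  have hd : ∀ v, (SubC.nb G Finset.univ v).card ≤ 3 := by
    intro v
    have : SubC.nb G Finset.univ v = G.neighborFinset v := by ext; simp [SubC.nb]
    rw [this]; exact hdeg v
  obtain ⟨F, hF1, hF2, hF3⟩ := SubC.pack Finset.univ hd hgood
  choose f hf0 hfpos hfform using fun S : F => SubC.good_vec G S.1 (hF1 S.1 S.2).2
  have hA : (G.adjMatrix ℝ).IsHermitian := by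
    rw [Matrix.IsHermitian, Matrix.conjTranspose_eq_transpose_of_trivial]
    exact SimpleGraph.transpose_adjMatrix ..
  have hsep : ∀ S T : F, S ≠ T → ∀ x y, f S x ≠ 0 → f T y ≠ 0 → x ≠ y ∧ ¬ G.Adj x y := by
    intro S T hST x y hx hy
    refine hF2 S.1 S.2 T.1 T.2 (fun h => hST (Subtype.ext h)) x ?_ y ?_
    · by_contra h; exact hx (hf0 S x h)
    · by_contra h; exact hy (hf0 T y h)
  have key := SubC.interlace (G.adjMatrix ℝ) hA (√3) f hfpos hfform ?_ ?_
  · have hch : (G.adjMatrix ℝ).charpoly =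
        ∏ i, (Polynomial.X - Polynomial.C (μ i)) := by
      rw [← hμ.2]
      congr!
    rw [SubC.count_eq _ hA (√3) μ hch] at key
    simp only [Fintype.card_coe] at key
    rw [Finset.card_univ] at hF3
    have h1 : Fintype.card V ≤ 30 * {i : Fin (Fintype.card V) | Real.sqrt 3 ≤ μ i}.ncard := by
      omega
    have h2 : (Fintype.card V : ℝ) ≤
        30 * (({i : Fin (Fintype.card V) | Real.sqrt 3 ≤ μ i}.ncard : ℕ) : ℝ) := by
      exact_mod_cast h1
    linarith
  · intro S T hST
    refine Finset.sum_eq_zero fun x _ => ?_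
    by_contra h
    exact (hsep S T hST x x (left_ne_zero_of_mul h) (right_ne_zero_of_mul h)).1 rfl
  · intro S T hST
    refine Finset.sum_eq_zero fun x _ => ?_
    by_contra h
    have hx := left_ne_zero_of_mul h
    refine right_ne_zero_of_mul h ?_
    refine Finset.sum_eq_zero fun y _ => ?_
    by_contra h'
    have hy := right_ne_zero_of_mul h'
    have := (hsep S T hST x y hx hy).2
    simp [this] at h'
end

section
/- Let Δ ≥ δ ≥ 2 be integers and let ε > 0 be a real number. Then there is a constant c ≥ 1 (depending only on Δ, δ and ε) such that every finite simple graph of order n with maximum degree at most Δ and minimum degree at least δ has at least ⌈n/c⌉ eigenvalues (counted with multiplicity) that are strictly larger than 2√(δ−1) − ε. -/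
/-- Raw radial sequence. -/
noncomputable def radSeq (q t : ℝ) : ℕ → ℝ
  | 0 => 1
  | 1 => 1
  | (i+2) => (t * radSeq q t (i+1) - radSeq q t i) / q

theorem radial_exists (q t : ℝ) (hq : 1 ≤ q) (htq : t ^ 2 < 4 * q) :
    ∃ (g : ℕ → ℝ) (R : ℕ), Antitone g ∧ (∀ i, 0 ≤ g i) ∧ g 0 = 1 ∧ g 1 = 1 ∧
      (∀ i, t * g (i+1) ≤ g i + q * g (i+2)) ∧ ∀ k, R ≤ k → g k = 0 := by
  have hq0 : 0 < q := by linarith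
  set a := radSeq q t with ha
  have a0 : a 0 = 1 := by simp [ha, radSeq]
  have a1 : a 1 = 1 := by simp [ha, radSeq]
  have arec : ∀ i, q * a (i+2) = t * a (i+1) - a i := by
    intro i
    have : a (i+2) = (t * a (i+1) - a i) / q := by simp [ha, radSeq]
    rw [this]; field_simp
  obtain ⟨c, hc⟩ : ∃ c, c = (1 - t^2/(4*q))/q := ⟨_, rfl⟩
  have hqc : q * c = 1 - t^2/(4*q) := by rw [hc]; field_simp
  have hm : t^2/(4*q) < 1 := by rw [div_lt_one (by linarith)]; exact htq
  have hc0 : 0 < c := by rw [hc]; apply div_pos <;> linarith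
  have key : ∀ i, (∀ j ≤ i, 0 < a j) → a (i+1) ≤ (1 - i * c) * a i := by
    intro i
    induction i with
    | zero => intro _; simp [a0, a1]
    | succ i ih =>
      intro hpos
      have h1 := ih (fun j hj => hpos j (by omega))
      have hb : 0 < a (i+1) := hpos _ le_rfl
      have haa : 0 < a i := hpos _ (by omega)
      have hr := arec i
      obtain ⟨s, hs⟩ : ∃ s, s = 1 - (i:ℝ) * c := ⟨_, rfl⟩
      rw [← hs] at h1
      have hs1 : s ≤ 1 := by rw [hs]; have : 0 ≤ (i:ℝ) * c := by positivity
                             linarith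
      have hs0 : 0 < s := by
        by_contra h
        have : s * a i ≤ 0 := mul_nonpos_of_nonpos_of_nonneg (by linarith) haa.le
        linarith
      push_cast
      have e : (1 - ((i:ℝ)+1) * c) = s - c := by rw [hs]; ring
      rw [e]
      -- q s^2 - t s + m ≥ 0
      have hsq : 0 ≤ q * s^2 - t * s + t^2/(4*q) := by
        have : q * s^2 - t * s + t^2/(4*q) = (2*q*s - t)^2/(4*q) := by field_simp; ring
        rw [this]; positivity
      have h2 : q * s^2 - t * s + 1 ≥ q * c * s := by
        rw [hqc]; nlinarith
      have h3 : s * (q * a (i+2)) ≤ s * (q * ((s - c) * a (i+1))) := by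
        rw [hr]
        nlinarith [mul_le_mul_of_nonneg_right h2.le hb.le]
      have h4 := le_of_mul_le_mul_left h3 hs0
      exact le_of_mul_le_mul_left h4 hq0
  have hex : ∃ k, a k ≤ 0 := by
    by_contra h
    push Not at h
    obtain ⟨N, hN⟩ := exists_nat_gt (1 / c)
    have h1 := key N (fun j _ => h j)
    have h2 : 1 < N * c := by rwa [div_lt_iff₀ hc0] at hN
    nlinarith [h N, h (N+1)]
  classical
  let K := Nat.find hex
  have hK : a K ≤ 0 := Nat.find_spec hex
  have hpos : ∀ j < K, 0 < a j := fun j hj => not_le.mp (Nat.find_min hex hj)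
  have hK2 : 2 ≤ K := by
    by_contra h
    have : K = 0 ∨ K = 1 := by omega
    rcases this with h | h <;> rw [h] at hK <;> linarith
  refine ⟨fun k => if k < K then a k else 0, K, ?_, ?_, ?_, ?_, ?_, ?_⟩
  · apply antitone_nat_of_succ_le
    intro i
    by_cases h : i + 1 < K
    · simp only [h, if_true, show i < K by omega]
      have h1 := key i (fun j hj => hpos j (by omega))
      have h2 : 0 ≤ (i:ℝ) * c := by positivity
      nlinarith [hpos i (by omega)]
    · simp only [h, if_false]
      split_ifs with h3
      · exact (hpos i h3).le
      · exact le_rfl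
  · intro i
    dsimp only
    split_ifs with h3
    · exact (hpos i h3).le
    · exact le_rfl
  · simp [a0, show 0 < K by omega]
  · simp [a1, show 1 < K by omega]
  · intro i
    dsimp only
    have hr := arec i
    by_cases h2 : i + 2 < K
    · simp only [h2, if_true, show i < K by omega, show i + 1 < K by omega]
      linarith
    · by_cases h1 : i + 1 < K
      · have : i + 2 = K := by omega
        simp only [h2, h1, if_true, if_false, show i < K by omega]
        rw [this] at hr
        nlinarith
      · simp only [h2, h1, if_false]
        split_ifs with h3
        · have := hpos i h3
          linarith
        · linarith
  · intro k hk
    simp [not_lt.mpr hk]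

open Matrix in
/-- Number of eigenvalues above `t` is at least the dimension of a space on which the
form is at least `l > t`. -/
theorem card_le_card_eigenvalues {n : ℕ} {S : Type*} [Fintype S] [DecidableEq S]
    (A : Matrix (Fin n) (Fin n) ℝ) (hA : A.IsHermitian) (t l : ℝ) (htl : t < l)
    (L : (S → ℝ) →ₗ[ℝ] (Fin n → ℝ)) (hL : Function.Injective L)
    (hform : ∀ x, l * (L x ⬝ᵥ L x) ≤ L x ⬝ᵥ (A *ᵥ L x)) :
    Fintype.card S ≤ Fintype.card {i // t < hA.eigenvalues i} := by
  classical
  let U : Matrix (Fin n) (Fin n) ℝ := hA.eigenvectorUnitary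
  have hU : U * Uᵀ = 1 := by
    have := Matrix.mem_unitaryGroup_iff.mp hA.eigenvectorUnitary.2
    simpa [Matrix.star_eq_conjTranspose, conjTranspose_eq_transpose_of_trivial] using this
  have hspec : A = U * diagonal hA.eigenvalues * Uᵀ := by
    have := hA.spectral_theorem
    rw [Unitary.conjStarAlgAut_apply] at this
    simpa [Matrix.star_eq_conjTranspose, conjTranspose_eq_transpose_of_trivial] using this
  have hn : ∀ f : Fin n → ℝ, f ⬝ᵥ f = ∑ i, (Uᵀ *ᵥ f) i ^ 2 := by
    intro f
    have : f ⬝ᵥ f = f ⬝ᵥ ((U * Uᵀ) *ᵥ f) := by rw [hU, one_mulVec]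
    rw [this, ← mulVec_mulVec, dotProduct_mulVec, ← mulVec_transpose]
    simp [dotProduct, sq]
  have hq : ∀ f : Fin n → ℝ, f ⬝ᵥ (A *ᵥ f) = ∑ i, hA.eigenvalues i * (Uᵀ *ᵥ f) i ^ 2 := by
    intro f
    conv_lhs => rw [hspec]
    rw [← mulVec_mulVec, ← mulVec_mulVec, dotProduct_mulVec, ← mulVec_transpose]
    simp only [dotProduct, mulVec_diagonal]
    exact Finset.sum_congr rfl (fun i _ => by ring)
  let P : (S → ℝ) →ₗ[ℝ] ({i // t < hA.eigenvalues i} → ℝ) :=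
    (LinearMap.funLeft ℝ ℝ (Subtype.val)) ∘ₗ (Matrix.mulVecLin Uᵀ) ∘ₗ L
  have hP : Function.Injective P := by
    rw [injective_iff_map_eq_zero]
    intro x hx
    have hz : ∀ i, t < hA.eigenvalues i → (Uᵀ *ᵥ L x) i = 0 := by
      intro i hi
      exact congrFun hx ⟨i, hi⟩
    have h1 : L x ⬝ᵥ (A *ᵥ L x) ≤ t * (L x ⬝ᵥ L x) := by
      rw [hq, hn, Finset.mul_sum]
      apply Finset.sum_le_sum
      intro i _
      by_cases h : t < hA.eigenvalues i
      · simp [hz i h]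
      · exact mul_le_mul_of_nonneg_right (not_lt.mp h) (sq_nonneg _)
    have h2 := hform x
    have h3 : 0 ≤ L x ⬝ᵥ L x := by rw [hn]; positivity
    have h4 : L x ⬝ᵥ L x = 0 := by nlinarith
    have h5 : L x = 0 := dotProduct_self_eq_zero.mp h4
    exact hL (by rw [h5, map_zero])
  have := LinearMap.finrank_le_finrank_of_injective hP
  simpa using this

theorem card_ball_le {n : ℕ} (Δ : ℕ) (G : SimpleGraph (Fin n)) [DecidableRel G.Adj]
    (hΔ : ∀ v, G.degree v ≤ Δ) (k : ℕ) (v : Fin n) :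
    ∃ B : Finset (Fin n), B.card ≤ (Δ + 1) ^ k ∧
      ∀ u, ∀ p : G.Walk u v, p.length ≤ k → u ∈ B := by
  induction k with
  | zero =>
    refine ⟨{v}, by simp, fun u p hp => ?_⟩
    have := SimpleGraph.Walk.eq_of_length_eq_zero (p := p) (by omega)
    simp [this]
  | succ k ih =>
    obtain ⟨B, hB, hB'⟩ := ih
    refine ⟨B.biUnion (fun u => insert u (G.neighborFinset u)), ?_, ?_⟩
    · calc _ ≤ B.card * (Δ + 1) := by
            apply Finset.card_biUnion_le_card_mul
            intro u _
            refine (Finset.card_insert_le _ _).trans ?_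
            rw [SimpleGraph.card_neighborFinset_eq_degree]
            have := hΔ u
            omega
        _ ≤ _ := by rw [pow_succ]; exact Nat.mul_le_mul_right _ hB
    · intro u p hp
      rw [Finset.mem_biUnion]
      cases p with
      | nil => exact ⟨v, hB' v SimpleGraph.Walk.nil (by simp), by simp⟩
      | @cons _ w _ h p =>
        refine ⟨w, hB' w p (by simpa using hp), ?_⟩
        simp [h.symm]

open Matrix in
/-- Local test functions. -/
theorem local_test {n : ℕ} (δ : ℕ) (G : SimpleGraph (Fin n)) [DecidableRel G.Adj]
    (hδ2 : 2 ≤ δ)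
    (hδ : ∀ v, δ ≤ G.degree v) (t : ℝ) (ht : t ≤ δ) (g : ℕ → ℝ) (R : ℕ)
    (hg : Antitone g) (hg0 : ∀ i, 0 ≤ g i) (h0 : g 0 = 1) (h1 : g 1 = 1)
    (hrec : ∀ i, t * g (i+1) ≤ g i + ((δ:ℝ) - 1) * g (i+2)) (hR : ∀ k, R ≤ k → g k = 0)
    (v : Fin n) :
    ∃ f : Fin n → ℝ, f v = 1 ∧ (∀ u, f u ≠ 0 → ∃ p : G.Walk u v, p.length < R) ∧
      t * (f ⬝ᵥ f) ≤ f ⬝ᵥ (G.adjMatrix ℝ *ᵥ f) := by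
  classical
  let f : Fin n → ℝ := fun u => if G.Reachable u v then g (G.dist u v) else 0
  have hf0 : ∀ u, 0 ≤ f u := by
    intro u; dsimp only [f]; split_ifs
    · exact hg0 _
    · exact le_rfl
  have hfw : ∀ u (p : G.Walk u v) k, p.length ≤ k → g k ≤ f u := by
    intro u p k hk
    have : f u = g (G.dist u v) := if_pos ⟨p⟩
    rw [this]
    exact hg ((SimpleGraph.dist_le p).trans hk)
  refine ⟨f, by simp [f, h0], ?_, ?_⟩
  · intro u hu
    have hr : G.Reachable u v := by
      by_contra h; exact hu (if_neg h)
    obtain ⟨p, hp⟩ := hr.exists_walk_length_eq_dist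
    refine ⟨p, ?_⟩
    by_contra h
    apply hu
    have : f u = g (G.dist u v) := if_pos hr
    rw [this]
    exact hR _ (by omega)
  · have key : ∀ u, t * f u ≤ (G.adjMatrix ℝ *ᵥ f) u ∨ f u = 0 := by
      intro u
      by_cases hr : G.Reachable u v
      · left
        rw [SimpleGraph.adjMatrix_mulVec_apply]
        have hfu : f u = g (G.dist u v) := if_pos hr
        obtain ⟨p, hp⟩ := hr.exists_walk_length_eq_dist
        rw [hfu, ← hp]
        have hd : (δ:ℝ) ≤ (G.neighborFinset u).card := by
          rw [SimpleGraph.card_neighborFinset_eq_degree]; exact_mod_cast hδ u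
        cases p with
        | nil =>
          have : ∑ w ∈ G.neighborFinset v, (1:ℝ) ≤ ∑ w ∈ G.neighborFinset v, f w := by
            apply Finset.sum_le_sum
            intro w hw
            rw [SimpleGraph.mem_neighborFinset] at hw
            rw [← h1]
            exact hfw w (SimpleGraph.Walk.cons hw.symm SimpleGraph.Walk.nil) 1 (by simp)
          simp only [SimpleGraph.Walk.length_nil, h0]
          simp only [Finset.sum_const, nsmul_eq_mul] at this
          linarith
        | @cons _ w0 _ h p =>
          have hmem : w0 ∈ G.neighborFinset u := by simpa using h
          rw [← Finset.add_sum_erase _ _ hmem]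
          simp only [SimpleGraph.Walk.length_cons]
          have e1 := hfw w0 p p.length le_rfl
          have e2 : ∑ w ∈ (G.neighborFinset u).erase w0, g (p.length + 2) ≤
              ∑ w ∈ (G.neighborFinset u).erase w0, f w := by
            apply Finset.sum_le_sum
            intro w hw
            have hw := Finset.mem_of_mem_erase hw
            rw [SimpleGraph.mem_neighborFinset] at hw
            exact hfw w (SimpleGraph.Walk.cons hw.symm (SimpleGraph.Walk.cons h p)) _ (by simp)
          rw [Finset.sum_const, nsmul_eq_mul, Finset.card_erase_of_mem hmem,
            Nat.cast_sub (Finset.card_pos.mpr ⟨_, hmem⟩)] at e2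
          have e3 := hrec p.length
          have e4 := hg0 (p.length + 2)
          push_cast at e2
          nlinarith
      · right; exact if_neg hr
    simp only [dotProduct, Finset.mul_sum]
    apply Finset.sum_le_sum
    intro u _
    rcases key u with h | h
    · nlinarith [hf0 u]
    · simp [h]

theorem exists_separated {n : ℕ} (Δ : ℕ) (G : SimpleGraph (Fin n)) [DecidableRel G.Adj]
    (hΔ : ∀ v, G.degree v ≤ Δ) (k : ℕ) :
    ∃ S : Finset (Fin n), n ≤ S.card * (Δ + 1) ^ k ∧
      ∀ v ∈ S, ∀ w ∈ S, v ≠ w → ∀ p : G.Walk v w, k < p.length := by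
  classical
  let F : Finset (Finset (Fin n)) := Finset.univ.filter
    (fun S => ∀ v ∈ S, ∀ w ∈ S, v ≠ w → ∀ p : G.Walk v w, k < p.length)
  have hF : F.Nonempty := ⟨∅, by simp [F]⟩
  obtain ⟨S, hS, hmax⟩ := Finset.exists_max_image F Finset.card hF
  have hS' := (Finset.mem_filter.mp hS).2
  refine ⟨S, ?_, hS'⟩
  choose B hB hB' using fun v => card_ball_le Δ G hΔ k v
  have hcov : (Finset.univ : Finset (Fin n)) ⊆ S.biUnion B := by
    intro u _
    by_contra hu
    have hno : ∀ v ∈ S, ∀ p : G.Walk u v, k < p.length := by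
      intro v hv p
      by_contra h
      exact hu (Finset.mem_biUnion.mpr ⟨v, hv, hB' v u p (by omega)⟩)
    have huS : u ∉ S := fun h => by
      have := hno u h SimpleGraph.Walk.nil
      simp at this
    have : insert u S ∈ F := by
      refine Finset.mem_filter.mpr ⟨Finset.mem_univ _, ?_⟩
      intro v hv w hw hvw p
      rw [Finset.mem_insert] at hv hw
      rcases hv with rfl | hv <;> rcases hw with rfl | hw
      · exact absurd rfl hvw
      · exact hno w hw p
      · have := hno v hv p.reverse
        simpa using this
      · exact hS' v hv w hw hvw p
    have := hmax _ this
    rw [Finset.card_insert_of_notMem huS] at this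
    omega
  have := Finset.card_le_card hcov
  rw [Finset.card_univ, Fintype.card_fin] at this
  exact this.trans (Finset.card_biUnion_le_card_mul _ _ _ (fun v _ => hB v))

open Matrix in
theorem card_eigs {n : ℕ} (δ : ℕ) (G : SimpleGraph (Fin n)) [DecidableRel G.Adj]
    (hδ2 : 2 ≤ δ)
    (hδ : ∀ v, δ ≤ G.degree v) (s t : ℝ) (hst : s < t) (ht : t ≤ δ) (g : ℕ → ℝ) (R : ℕ)
    (hg : Antitone g) (hg0 : ∀ i, 0 ≤ g i) (h0 : g 0 = 1) (h1 : g 1 = 1)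
    (hrec : ∀ i, t * g (i+1) ≤ g i + ((δ:ℝ) - 1) * g (i+2)) (hR : ∀ k, R ≤ k → g k = 0)
    (hA : (G.adjMatrix ℝ).IsHermitian) (S : Finset (Fin n))
    (hS : ∀ v ∈ S, ∀ w ∈ S, v ≠ w → ∀ p : G.Walk v w, 2 * R < p.length) :
    S.card ≤ Fintype.card {i // s < hA.eigenvalues i} := by
  classical
  choose f hf1 hf2 hf3 using fun v => local_test δ G hδ2 hδ t ht g R hg hg0 h0 h1 hrec hR v
  let L : (S → ℝ) →ₗ[ℝ] (Fin n → ℝ) := Fintype.linearCombination ℝ (fun v : S => f v)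
  have hLx : ∀ x, L x = ∑ v : S, x v • f v := fun x => Fintype.linearCombination_apply _ _ _
  have hdisj : ∀ v w : S, v ≠ w → ∀ u, f v u = 0 ∨ f w u = 0 := by
    intro v w hvw u
    by_contra h
    push Not at h
    obtain ⟨p, hp⟩ := hf2 v u h.1
    obtain ⟨p', hp'⟩ := hf2 w u h.2
    have := hS v v.2 w w.2 (fun h => hvw (Subtype.ext h)) (p.reverse.append p')
    simp at this
    omega
  have hdisjA : ∀ v w : S, v ≠ w → ∀ u u', G.Adj u u' → f v u = 0 ∨ f w u' = 0 := by
    intro v w hvw u u' ha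
    by_contra h
    push Not at h
    obtain ⟨p, hp⟩ := hf2 v u h.1
    obtain ⟨p', hp'⟩ := hf2 w u' h.2
    have := hS v v.2 w w.2 (fun h => hvw (Subtype.ext h))
      (p.reverse.append (SimpleGraph.Walk.cons ha p'))
    simp at this
    omega
  have hd1 : ∀ v w : S, v ≠ w → f v ⬝ᵥ f w = 0 := by
    intro v w hvw
    refine Finset.sum_eq_zero (fun u _ => ?_)
    rcases hdisj v w hvw u with h | h <;> simp [h]
  have hd2 : ∀ v w : S, v ≠ w → f v ⬝ᵥ (G.adjMatrix ℝ *ᵥ f w) = 0 := by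
    intro v w hvw
    refine Finset.sum_eq_zero (fun u _ => ?_)
    rw [SimpleGraph.adjMatrix_mulVec_apply, Finset.mul_sum]
    refine Finset.sum_eq_zero (fun u' hu' => ?_)
    rw [SimpleGraph.mem_neighborFinset] at hu'
    rcases hdisjA v w hvw u u' hu' with h | h <;> simp [h]
  have hn1 : ∀ x, L x ⬝ᵥ L x = ∑ v : S, x v ^ 2 * (f v ⬝ᵥ f v) := by
    intro x
    rw [hLx, sum_dotProduct]
    refine Finset.sum_congr rfl (fun v _ => ?_)
    rw [dotProduct_sum, Finset.sum_eq_single v]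
    · simp only [smul_dotProduct, dotProduct_smul, smul_eq_mul]; ring
    · intro w _ hw
      simp [smul_dotProduct, dotProduct_smul, hd1 v w hw.symm]
    · simp
  have hn2 : ∀ x, L x ⬝ᵥ (G.adjMatrix ℝ *ᵥ L x)
      = ∑ v : S, x v ^ 2 * (f v ⬝ᵥ (G.adjMatrix ℝ *ᵥ f v)) := by
    intro x
    rw [hLx, sum_dotProduct]
    refine Finset.sum_congr rfl (fun v _ => ?_)
    rw [Matrix.mulVec_sum, dotProduct_sum, Finset.sum_eq_single v]
    · simp only [smul_dotProduct, dotProduct_smul, mulVec_smul, smul_eq_mul]; ring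
    · intro w _ hw
      simp [smul_dotProduct, dotProduct_smul, mulVec_smul, hd2 v w hw.symm]
    · simp
  have hinj : Function.Injective L := by
    rw [injective_iff_map_eq_zero]
    intro x hx
    funext v
    have h := congrFun hx v
    rw [hLx, Finset.sum_apply, Finset.sum_eq_single v] at h
    · simpa [hf1] using h
    · intro w _ hw
      rcases hdisj v w hw.symm v with h' | h'
      · rw [hf1] at h'; norm_num at h'
      · simp [h']
    · simp
  have := card_le_card_eigenvalues (S := S) (G.adjMatrix ℝ) hA s t hst L hinj (by
    intro x
    rw [hn1, hn2, Finset.mul_sum]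
    refine Finset.sum_le_sum (fun v _ => ?_)
    nlinarith [mul_le_mul_of_nonneg_left (hf3 v) (sq_nonneg (x v))])
  simpa using this

open Polynomial in
theorem ncard_eq {n : ℕ} (A : Matrix (Fin n) (Fin n) ℝ) (hA : A.IsHermitian)
    (μ : Fin (Fintype.card (Fin n)) → ℝ)
    (h : A.charpoly = ∏ i, (X - C (μ i))) (s : ℝ) :
    {i | s < μ i}.ncard = Fintype.card {i // s < hA.eigenvalues i} := by
  classical
  have h1 : A.charpoly = ∏ i, (X - C (hA.eigenvalues i)) := by
    simpa using hA.charpoly_eq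
  have h2 : Finset.univ.val.map μ = Finset.univ.val.map hA.eigenvalues := by
    have e1 : A.charpoly.roots = Finset.univ.val.map μ := by
      rw [h]; exact Polynomial.roots_multiset_prod_X_sub_C (Finset.univ.val.map μ) ▸ by
        rw [Multiset.map_map]; rfl
    have e2 : A.charpoly.roots = Finset.univ.val.map hA.eigenvalues := by
      rw [h1]; exact Polynomial.roots_multiset_prod_X_sub_C (Finset.univ.val.map hA.eigenvalues) ▸ by
        rw [Multiset.map_map]; rfl
    rw [← e1, e2]
  have h3 := congrArg (Multiset.countP (fun x => s < x)) h2
  rw [Multiset.countP_map, Multiset.countP_map] at h3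
  rw [Set.ncard_eq_toFinset_card', Fintype.card_subtype]
  simpa [Finset.card_def, Finset.filter_val] using h3

/-- For all integers `Δ ≥ δ ≥ 2` and every real `ε > 0` there is a
constant `c ≥ 1` (depending only on `Δ`, `δ`, `ε`) such that every graph of order
`n` with maximum degree at most `Δ` and minimum degree at least `δ` has at least
`⌈n/c⌉` eigenvalues (with multiplicity) strictly larger than `2√(δ-1) - ε`. -/
theorem many_large_eigenvalues_of_min_degree
    (Δ δ : ℕ) (hδ2 : 2 ≤ δ) (hδΔ : δ ≤ Δ) (ε : ℝ) (hε : 0 < ε) :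
    ∃ c : ℝ, 1 ≤ c ∧
      ∀ (n : ℕ) (G : SimpleGraph (Fin n)) (_ : DecidableRel G.Adj),
        (∀ v, G.degree v ≤ Δ) → (∀ v, δ ≤ G.degree v) →
        ∀ (μ : Fin (Fintype.card (Fin n)) → ℝ), G.IsEigenvalueSeq μ →
          ⌈(n : ℝ) / c⌉ ≤
            (({i : Fin (Fintype.card (Fin n)) |
                2 * Real.sqrt ((δ : ℝ) - 1) - ε < μ i}.ncard : ℕ) : ℤ) := by
  obtain ⟨q, hq⟩ : ∃ q : ℝ, q = (δ:ℝ) - 1 := ⟨_, rfl⟩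
  have hδR : (2:ℝ) ≤ δ := by exact_mod_cast hδ2
  have hq1 : 1 ≤ q := by linarith
  obtain ⟨e, he0, he1, heε⟩ : ∃ e : ℝ, 0 < e ∧ e ≤ 1 ∧ e < ε := by
    refine ⟨min 1 (ε / 2), by positivity, min_le_left _ _, ?_⟩
    exact (min_le_right _ _).trans_lt (by linarith)
  have hsq : Real.sqrt q ^ 2 = q := Real.sq_sqrt (by linarith)
  have hs1 : 1 ≤ Real.sqrt q := Real.one_le_sqrt.mpr hq1
  obtain ⟨t, ht⟩ : ∃ t, t = 2 * Real.sqrt q - e := ⟨_, rfl⟩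
  have htq : t ^ 2 < 4 * q := by rw [ht]; nlinarith
  have htδ : t ≤ δ := by
    have : t ≤ q + 1 := by rw [ht]; nlinarith [sq_nonneg (Real.sqrt q - 1)]
    linarith
  obtain ⟨g, R, hg, hg0, h0, h1, hrec, hR⟩ := radial_exists q t hq1 htq
  refine ⟨((Δ:ℝ) + 1) ^ (2 * R), one_le_pow₀ (by linarith [(Nat.cast_nonneg Δ : (0:ℝ) ≤ Δ)]), ?_⟩
  intro n G inst hΔ' hδ' μ hμ
  have hA : (G.adjMatrix ℝ).IsHermitian := by
    rw [Matrix.IsHermitian, Matrix.conjTranspose_eq_transpose_of_trivial,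
      SimpleGraph.transpose_adjMatrix]
  have hchar := hμ.2
  have hinst : inst = Classical.decRel _ := Subsingleton.elim _ _
  obtain ⟨S, hS, hS'⟩ := exists_separated Δ G hΔ' (2 * R)
  rw [hq] at hrec
  have hcard := card_eigs δ G hδ2 hδ' (2 * Real.sqrt ((δ:ℝ) - 1) - ε) t
    (by rw [ht, hq]; linarith) htδ g R hg hg0 h0 h1 hrec hR hA S hS'
  rw [ncard_eq (G.adjMatrix ℝ) hA μ (by rw [← hchar]; congr!) _]
  rw [Int.ceil_le, div_le_iff₀ (by positivity)]
  have h5 : n ≤ Fintype.card {i // 2 * Real.sqrt ((δ:ℝ) - 1) - ε < hA.eigenvalues i} *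
      (Δ + 1) ^ (2 * R) := hS.trans (Nat.mul_le_mul_right _ hcard)
  exact_mod_cast h5
end
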